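/- arXiv:1309.2042 — 5 statements merged into one kernel-verified Lean document; each statement's English description precedes it below -/
import Mathlib

section
/- Let n ≥ 2 and let a_1 ≥ a_2 ≥ ... ≥ a_n > 0. Let Ω = {x ∈ ℝ^n : Σ_{j=1}^n x_j²/a_j² ≤ 1} be an ellipsoid with boundary Γ = {x ∈ ℝ^n : Σ_{j=1}^n x_j²/a_j² = 1}. Then for every real polynomial p in the variables x_1, ..., x_n there exists a real polynomial u in x_1, ..., x_n such that Δu = Σ_{j=1}^n ∂²u/∂x_j² = 0 identically on ℝ^n, u(x) = p(x) for every x ∈ Γ, and deg u ≤ deg p. -/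
open MvPolynomial

section PartialDerivatives

variable {σ : Type*}

lemma MvPolynomial.totalDegree_pderiv_le {R : Type*} [CommSemiring R] (i : σ)
    (p : MvPolynomial σ R) : (pderiv i p).totalDegree ≤ p.totalDegree - 1 := by
  classical
  conv_lhs => rw [p.as_sum, map_sum]
  refine totalDegree_finsetSum_le fun s hs => ?_
  rw [pderiv_monomial]
  rcases Nat.eq_zero_or_pos (s i) with h | h
  · simp [h]
  · refine (totalDegree_monomial_le _ _).trans ?_
    have hsum : s - Finsupp.single i 1 + Finsupp.single i 1 = s :=
      tsub_add_cancel_of_le (Finsupp.single_le_iff.mpr h)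
    have hdeg := congrArg Finsupp.degree hsum
    rw [map_add, Finsupp.degree_single] at hdeg
    have hle := le_totalDegree hs
    change (s - Finsupp.single i 1).degree ≤ _
    change s.degree ≤ _ at hle
    omega

lemma MvPolynomial.hasDerivAt_eval_update [DecidableEq σ] (p : MvPolynomial σ ℝ) (x : σ → ℝ)
    (i : σ) (t : ℝ) :
    HasDerivAt (fun s => eval (Function.update x i s) p)
      (eval (Function.update x i t) (pderiv i p)) t := by
  induction p using MvPolynomial.induction_on with
  | C c => simpa using hasDerivAt_const t c
  | add p q hp hq => simpa using hp.fun_add hq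
  | mul_X p j hp =>
    have hX : HasDerivAt (fun s => Function.update x i s j)
        (eval (Function.update x i t) (pderiv i (X j : MvPolynomial σ ℝ))) t := by
      rcases eq_or_ne j i with rfl | h
      · simpa using hasDerivAt_id' t
      · simpa [pderiv_X_of_ne h, h] using hasDerivAt_const t (x j)
    have h := hp.fun_mul hX
    simp only [Derivation.leibniz, map_mul, map_add, eval_X, smul_eq_mul]
    exact h.congr_deriv (by ring)

lemma MvPolynomial.eval_pderiv_pderiv_nonpos_of_isLocalMax {p : MvPolynomial σ ℝ} {x : σ → ℝ}
    (h : IsLocalMax (fun y => eval y p) x) (i : σ) :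
    eval x (pderiv i (pderiv i p)) ≤ 0 := by
  classical
  set f : ℝ → ℝ := fun s => eval (Function.update x i s) p with hf
  have hd : deriv f = fun s => eval (Function.update x i s) (pderiv i p) :=
    _root_.funext fun t => (p.hasDerivAt_eval_update x i t).deriv
  have hdd : deriv (deriv f) (x i) = eval x (pderiv i (pderiv i p)) := by
    rw [hd, ((pderiv i p).hasDerivAt_eval_update x i (x i)).deriv, Function.update_eq_self]
  have hmax : IsLocalMax f (x i) := by
    have hc : Filter.Tendsto (fun s => Function.update x i s) (nhds (x i)) (nhds x) := by
      have : Continuous fun s : ℝ => Function.update x i s := by fun_prop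
      simpa using this.tendsto (x i)
    have := hc.eventually h
    simpa [IsLocalMax, IsMaxFilter, hf] using this
  by_contra! hpos
  have hmin : IsLocalMin f (x i) := isLocalMin_of_deriv_deriv_pos (hdd ▸ hpos)
    hmax.deriv_eq_zero (p.hasDerivAt_eval_update x i (x i)).continuousAt
  have hconst : f =ᶠ[nhds (x i)] fun _ => f (x i) := by
    filter_upwards [hmax, hmin] with s h₁ h₂ using le_antisymm h₁ h₂
  have hzero : deriv (deriv f) (x i) = 0 := by
    rw [hconst.deriv.deriv_eq]
    simp
  exact hpos.ne' (hdd ▸ hzero)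

end PartialDerivatives

section Laplacian

variable {σ : Type*} [Fintype σ]

/-- The Laplacian `∑ⱼ ∂²/∂xⱼ²` on polynomials. -/
noncomputable def MvPolynomial.laplacian : MvPolynomial σ ℝ →ₗ[ℝ] MvPolynomial σ ℝ :=
  ∑ j, (pderiv j).toLinearMap ∘ₗ (pderiv j).toLinearMap

lemma MvPolynomial.laplacian_apply (p : MvPolynomial σ ℝ) :
    laplacian p = ∑ j, pderiv j (pderiv j p) := by
  simp [laplacian]

lemma MvPolynomial.totalDegree_laplacian_le (p : MvPolynomial σ ℝ) :
    (laplacian p).totalDegree ≤ p.totalDegree - 2 := by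
  rw [laplacian_apply]
  refine totalDegree_finsetSum_le fun j _ => ?_
  have h₁ := totalDegree_pderiv_le j (pderiv j p)
  have h₂ := totalDegree_pderiv_le j p
  omega

lemma MvPolynomial.laplacian_eq_zero_of_totalDegree_le_one {p : MvPolynomial σ ℝ}
    (h : p.totalDegree ≤ 1) : laplacian p = 0 := by
  rw [laplacian_apply]
  refine Finset.sum_eq_zero fun j _ => ?_
  have h₀ : (pderiv j p).totalDegree = 0 := by
    have := totalDegree_pderiv_le j p
    omega
  rw [totalDegree_eq_zero_iff_eq_C.mp h₀, pderiv_C]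

lemma MvPolynomial.laplacian_sum_X_sq :
    laplacian (∑ j, X j ^ 2 : MvPolynomial σ ℝ) = C (2 * (Fintype.card σ : ℝ)) := by
  classical
  have key : ∀ i j : σ, pderiv i (pderiv i (X j ^ 2 : MvPolynomial σ ℝ)) =
      if i = j then C 2 else 0 := by
    intro i j
    rcases eq_or_ne j i with rfl | h
    · simp [pow_two, Derivation.leibniz]
      rw [show (C 2 : MvPolynomial σ ℝ) = C (1 + 1) by norm_num, C_add, C_1]
    · simp [pow_two, Derivation.leibniz, pderiv_X_of_ne h, h.symm]
  simp only [laplacian_apply, map_sum, key, Finset.sum_ite_eq', Finset.mem_univ, if_true,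
    Finset.sum_const, Finset.card_univ, nsmul_eq_mul, C_mul, map_natCast]
  ring

/-- The weak maximum principle for harmonic polynomials on a compact set. -/
lemma MvPolynomial.eval_nonpos_of_laplacian_eq_zero [Nonempty σ] {u : MvPolynomial σ ℝ}
    (hu : laplacian u = 0) {K : Set (σ → ℝ)} (hK : IsCompact K)
    (hb : ∀ x ∈ K, x ∉ interior K → eval x u ≤ 0) {x : σ → ℝ} (hx : x ∈ K) :
    eval x u ≤ 0 := by
  have hN : Continuous fun y : σ → ℝ => eval y (∑ j, X j ^ 2 : MvPolynomial σ ℝ) :=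
    MvPolynomial.continuous_eval _
  obtain ⟨z, -, hz⟩ := hK.exists_isMaxOn ⟨x, hx⟩ hN.continuousOn
  set R : ℝ := eval z (∑ j, X j ^ 2 : MvPolynomial σ ℝ) with hR
  have hnonneg : ∀ y : σ → ℝ, 0 ≤ eval y (∑ j, X j ^ 2 : MvPolynomial σ ℝ) := fun y => by
    simpa using Finset.sum_nonneg fun j _ => sq_nonneg (y j)
  have hbound : ∀ ε > 0, eval x u ≤ ε * R := by
    intro ε hε
    set w : MvPolynomial σ ℝ := u + ε • ∑ j, X j ^ 2 with hw
    have hwe : ∀ y, eval y w = eval y u + ε * eval y (∑ j, X j ^ 2 : MvPolynomial σ ℝ) :=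
      fun y => by rw [hw, map_add, smul_eval]
    obtain ⟨y, hyK, hy⟩ := hK.exists_isMaxOn ⟨x, hx⟩ (MvPolynomial.continuous_eval w).continuousOn
    have hyb : y ∉ interior K := by
      intro hyi
      have hloc : IsLocalMax (fun y => eval y w) y := hy.isLocalMax (mem_interior_iff_mem_nhds.mp hyi)
      have hle : eval y (laplacian w) ≤ 0 := by
        rw [laplacian_apply, map_sum]
        exact Finset.sum_nonpos fun j _ => eval_pderiv_pderiv_nonpos_of_isLocalMax hloc j
      rw [hw, map_add, map_smul, hu, laplacian_sum_X_sq, zero_add, smul_eval, eval_C] at hle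
      have : (0 : ℝ) < Fintype.card σ := by exact_mod_cast Fintype.card_pos
      have : 0 < ε * (2 * (Fintype.card σ : ℝ)) := by positivity
      linarith
    have h₁ : eval x w ≤ eval y w := hy hx
    have h₂ : eval y (∑ j, X j ^ 2 : MvPolynomial σ ℝ) ≤ R := hz hyK
    have h₃ := hb y hyK hyb
    have h₄ := mul_nonneg hε.le (hnonneg x)
    have h₅ := mul_le_mul_of_nonneg_left h₂ hε.le
    rw [hwe, hwe] at h₁
    linarith
  refine le_of_forall_pos_le_add fun δ hδ => ?_
  have hR₀ : 0 ≤ R := hnonneg z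
  refine (hbound (δ / (R + 1)) (by positivity)).trans ?_
  rw [zero_add, div_mul_eq_mul_div, div_le_iff₀ (by positivity)]
  nlinarith

end Laplacian

section Ellipsoid

variable {σ : Type*} [Fintype σ]

/-- The quadratic polynomial `∑ⱼ xⱼ² / aⱼ² - 1` cutting out the ellipsoid with semiaxes `a`. -/
noncomputable def ellipsoidPolynomial (a : σ → ℝ) : MvPolynomial σ ℝ :=
  ∑ j, C ((a j ^ 2)⁻¹) * X j ^ 2 - 1

lemma eval_ellipsoidPolynomial (a x : σ → ℝ) :
    eval x (ellipsoidPolynomial a) = ∑ j, x j ^ 2 / a j ^ 2 - 1 := by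
  simp [ellipsoidPolynomial, div_eq_inv_mul]

lemma totalDegree_ellipsoidPolynomial_le (a : σ → ℝ) :
    (ellipsoidPolynomial a).totalDegree ≤ 2 := by
  refine (totalDegree_sub _ _).trans (max_le ?_ (by simp))
  refine totalDegree_finsetSum_le fun j _ => (totalDegree_mul _ _).trans ?_
  simp

lemma ellipsoidPolynomial_ne_zero (a : σ → ℝ) : ellipsoidPolynomial a ≠ 0 := by
  intro h
  have := eval_ellipsoidPolynomial a 0
  simp [h] at this

lemma isCompact_ellipsoid {a : σ → ℝ} (ha : ∀ j, 0 < a j) :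
    IsCompact {x : σ → ℝ | eval x (ellipsoidPolynomial a) ≤ 0} := by
  refine Metric.isCompact_of_isClosed_isBounded
    (isClosed_le (MvPolynomial.continuous_eval _) continuous_const) ?_
  refine (Metric.isBounded_Icc (-a) a).subset fun x hx => ?_
  rw [Set.mem_ofPred_eq, eval_ellipsoidPolynomial] at hx
  have habs : ∀ j, |x j| ≤ a j := fun j => by
    have h₁ : x j ^ 2 / a j ^ 2 ≤ ∑ j, x j ^ 2 / a j ^ 2 :=
      Finset.single_le_sum (f := fun j => x j ^ 2 / a j ^ 2) (fun i _ => by positivity)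
        (Finset.mem_univ j)
    have h₂ : x j ^ 2 / a j ^ 2 ≤ 1 := by linarith
    rw [div_le_one (pow_pos (ha j) 2)] at h₂
    exact abs_le_of_sq_le_sq h₂ (ha j).le
  exact ⟨fun j => (abs_le.mp (habs j)).1, fun j => (abs_le.mp (habs j)).2⟩

lemma eq_zero_of_eval_eq_zero_on_ellipsoid [Nonempty σ] {a : σ → ℝ} (ha : ∀ j, 0 < a j)
    {p : MvPolynomial σ ℝ} (h : ∀ x, eval x (ellipsoidPolynomial a) ≤ 0 → eval x p = 0) :
    p = 0 := by
  have hc : (1 : ℝ) ≤ Fintype.card σ := by exact_mod_cast Fintype.card_pos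
  refine funext_set (fun j => Set.Ioo 0 (a j / Fintype.card σ))
    (fun j => Set.Ioo_infinite (div_pos (ha j) (by linarith))) fun x hx => ?_
  rw [map_zero]
  refine h x ?_
  rw [eval_ellipsoidPolynomial, sub_nonpos]
  have hterm : ∀ j, x j ^ 2 / a j ^ 2 ≤ (Fintype.card σ : ℝ)⁻¹ := fun j => by
    obtain ⟨h₁, h₂⟩ := hx j (Set.mem_univ j)
    have h₃ : x j / a j ≤ (Fintype.card σ : ℝ)⁻¹ := by
      rw [div_le_iff₀ (ha j), inv_mul_eq_div]
      exact h₂.le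
    have h₄ : 0 ≤ x j / a j := (div_pos h₁ (ha j)).le
    have h₅ : (Fintype.card σ : ℝ)⁻¹ ≤ 1 := inv_le_one_of_one_le₀ hc
    rw [← div_pow]
    nlinarith
  calc ∑ j, x j ^ 2 / a j ^ 2 ≤ ∑ _j : σ, (Fintype.card σ : ℝ)⁻¹ :=
        Finset.sum_le_sum fun j _ => hterm j
    _ = 1 := by
        rw [Finset.sum_const, Finset.card_univ, nsmul_eq_mul, mul_inv_cancel₀ (by linarith)]

/-- A harmonic polynomial divisible by the defining polynomial of an ellipsoid vanishes. -/
lemma eq_zero_of_laplacian_ellipsoidPolynomial_mul_eq_zero [Nonempty σ] {a : σ → ℝ}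
    (ha : ∀ j, 0 < a j) {q : MvPolynomial σ ℝ} (h : laplacian (ellipsoidPolynomial a * q) = 0) :
    q = 0 := by
  have hb : ∀ x ∈ {x : σ → ℝ | eval x (ellipsoidPolynomial a) ≤ 0},
      x ∉ interior {x : σ → ℝ | eval x (ellipsoidPolynomial a) ≤ 0} →
      eval x (ellipsoidPolynomial a * q) = 0 := by
    intro x hx hxi
    suffices hE : eval x (ellipsoidPolynomial a) = 0 by rw [map_mul, hE, zero_mul]
    by_contra hne
    refine hxi (mem_interior.mpr ⟨{x | eval x (ellipsoidPolynomial a) < 0}, ?_, ?_, ?_⟩)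
    · exact fun y hy => (show eval y (ellipsoidPolynomial a) < 0 from hy).le
    · exact isOpen_lt (MvPolynomial.continuous_eval _) continuous_const
    · exact lt_of_le_of_ne hx hne
  have hzero : ellipsoidPolynomial a * q = 0 := by
    refine eq_zero_of_eval_eq_zero_on_ellipsoid ha fun x hx => le_antisymm ?_ ?_
    · exact eval_nonpos_of_laplacian_eq_zero h (isCompact_ellipsoid ha)
        (fun y hy hyi => (hb y hy hyi).le) hx
    · have hneg : laplacian (-(ellipsoidPolynomial a * q)) = 0 := by rw [map_neg, h, neg_zero]
      have := eval_nonpos_of_laplacian_eq_zero hneg (isCompact_ellipsoid ha)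
        (fun y hy hyi => by rw [map_neg, hb y hy hyi, neg_zero]) hx
      rw [map_neg] at this
      linarith
  exact (mul_eq_zero.mp hzero).resolve_left (ellipsoidPolynomial_ne_zero a)

lemma exists_laplacian_ellipsoidPolynomial_mul_eq [Nonempty σ] {a : σ → ℝ} (ha : ∀ j, 0 < a j)
    {m : ℕ} {f : MvPolynomial σ ℝ} (hf : f.totalDegree ≤ m) :
    ∃ q : MvPolynomial σ ℝ, q.totalDegree ≤ m ∧ laplacian (ellipsoidPolynomial a * q) = f := by
  let T : MvPolynomial σ ℝ →ₗ[ℝ] MvPolynomial σ ℝ :=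
    laplacian ∘ₗ LinearMap.mulLeft ℝ (ellipsoidPolynomial a)
  have hT : ∀ q ∈ restrictTotalDegree σ ℝ m, T q ∈ restrictTotalDegree σ ℝ m := by
    intro q hq
    rw [mem_restrictTotalDegree] at hq ⊢
    have h₁ := totalDegree_laplacian_le (ellipsoidPolynomial a * q)
    have h₂ := totalDegree_mul (ellipsoidPolynomial a) q
    have h₃ := totalDegree_ellipsoidPolynomial_le a
    change (laplacian (ellipsoidPolynomial a * q)).totalDegree ≤ m
    omega
  have hinj : Function.Injective (T.restrict hT) := by
    refine (injective_iff_map_eq_zero _).mpr fun q hq => Subtype.ext ?_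
    exact eq_zero_of_laplacian_ellipsoidPolynomial_mul_eq_zero ha (congrArg Subtype.val hq)
  obtain ⟨q, hq⟩ := LinearMap.surjective_of_injective hinj
    ⟨f, (mem_restrictTotalDegree _ _ _).mpr hf⟩
  exact ⟨q, (mem_restrictTotalDegree _ _ _).mp q.2, congrArg Subtype.val hq⟩

end Ellipsoid



/-- **Proposition 1.1** (Dirichlet problem on an ellipsoid with polynomial data).
For the ellipsoid `Ω = {x : Σ xⱼ²/aⱼ² ≤ 1}` with semiaxes `a₁ ≥ a₂ ≥ ⋯ ≥ aₙ > 0` and any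
real polynomial `p`, there is a harmonic polynomial `u` agreeing with `p` on the boundary
`Γ = {x : Σ xⱼ²/aⱼ² = 1}`, with `deg u ≤ deg p`. -/
theorem dirichlet_problem_ellipsoid_polynomial_data
    (n : ℕ) (hn : 2 ≤ n) (a : Fin n → ℝ) (hpos : ∀ j, 0 < a j)
    (hdecr : ∀ i j : Fin n, i ≤ j → a j ≤ a i)
    (p : MvPolynomial (Fin n) ℝ) :
    ∃ u : MvPolynomial (Fin n) ℝ,
      (∑ j, pderiv j (pderiv j u)) = 0 ∧
      (∀ x : Fin n → ℝ, (∑ j, (x j) ^ 2 / (a j) ^ 2) = 1 →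
        MvPolynomial.eval x u = MvPolynomial.eval x p) ∧
      u.totalDegree ≤ p.totalDegree := by
  have : Nonempty (Fin n) := ⟨⟨0, by omega⟩⟩
  rcases le_or_gt p.totalDegree 1 with hp | hp
  · exact ⟨p, by rw [← laplacian_apply, laplacian_eq_zero_of_totalDegree_le_one hp],
      fun _ _ => rfl, le_rfl⟩
  · obtain ⟨q, hq, hqp⟩ :=
      exists_laplacian_ellipsoidPolynomial_mul_eq hpos (totalDegree_laplacian_le p)
    refine ⟨p - ellipsoidPolynomial a * q, ?_, fun x hx => ?_, ?_⟩
    · rw [← laplacian_apply, map_sub, hqp, sub_self]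
    · rw [map_sub, map_mul, eval_ellipsoidPolynomial, hx, sub_self, zero_mul, sub_zero]
    · have h₁ := totalDegree_mul (ellipsoidPolynomial a) q
      have h₂ := totalDegree_ellipsoidPolynomial_le a
      exact (totalDegree_sub _ _).trans (max_le le_rfl (by omega))
end

section
/- Let N ≥ 2 and a_1 ≥ a_2 ≥ ... ≥ a_N > 0, and for λ > −a_N² let Ω_λ = {x ∈ ℝ^N : Σ_{j=1}^N x_j²/(a_j² + λ) ≤ 1} be the confocal family of ellipsoids. If u : ℝ^N → ℝ is harmonic on all of ℝ^N (Δu = 0 everywhere), then the average (1/vol(Ω_λ)) ∫_{Ω_λ} u(x) dx is independent of λ; that is, for all λ₁, λ₂ > −a_N², (1/vol(Ω_{λ₁})) ∫_{Ω_{λ₁}} u dx = (1/vol(Ω_{λ₂})) ∫_{Ω_{λ₂}} u dx. -/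
open MeasureTheory

/-- The Laplacian of `u : ℝᴺ → ℝ` at `x`, as the sum of second partial derivatives. -/
noncomputable def lap {N : ℕ} (u : (Fin N → ℝ) → ℝ) (x : Fin N → ℝ) : ℝ :=
  ∑ i, fderiv ℝ (fun y => fderiv ℝ u y (Pi.single i 1)) x (Pi.single i 1)

open Filter Topology

/-- The closed Euclidean unit ball, as a subset of `Fin N → ℝ`. -/
def euclideanUnitBall (N : ℕ) : Set (Fin N → ℝ) := {x | ∑ j, (x j) ^ 2 ≤ 1}

lemma euclideanUnitBall_subset_closedBall (N : ℕ) :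
    euclideanUnitBall N ⊆ Metric.closedBall 0 1 := by
  intro x hx
  rw [mem_closedBall_zero_iff, pi_norm_le_iff_of_nonneg zero_le_one]
  intro i
  have h : (x i) ^ 2 ≤ ∑ j, (x j) ^ 2 :=
    Finset.single_le_sum (f := fun j => (x j) ^ 2) (fun j _ => sq_nonneg _) (Finset.mem_univ i)
  have h' : (x i) ^ 2 ≤ 1 := h.trans hx
  rw [Real.norm_eq_abs]
  exact (sq_le_one_iff_abs_le_one _).1 h'

lemma isCompact_euclideanUnitBall (N : ℕ) : IsCompact (euclideanUnitBall N) := by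
  refine (isCompact_closedBall (0 : Fin N → ℝ) 1).of_isClosed_subset ?_
    (euclideanUnitBall_subset_closedBall N)
  exact isClosed_le (by fun_prop) continuous_const

lemma volume_euclideanUnitSphere {N : ℕ} (hN : 0 < N) :
    volume {x : Fin N → ℝ | ∑ j, (x j) ^ 2 = 1} = 0 := by
  have : Nonempty (Fin N) := ⟨⟨0, hN⟩⟩
  have h : {x : Fin N → ℝ | ∑ j, (x j) ^ 2 = 1} =
      WithLp.toLp 2 ⁻¹' Metric.sphere (0 : EuclideanSpace ℝ (Fin N)) 1 := by
    ext x
    simp only [Set.mem_ofPred_eq, Set.mem_preimage, mem_sphere_zero_iff_norm]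
    rw [EuclideanSpace.norm_eq, Real.sqrt_eq_one]
    simp
  rw [h, (PiLp.volume_preserving_toLp (Fin N)).measure_preimage
    Metric.isClosed_sphere.measurableSet.nullMeasurableSet]
  exact Measure.addHaar_sphere _ _ _

/-- Integration by parts on the unit ball against the coordinate `x i`, which is minus the
`i`-th partial derivative of `(1 - |x|²) / 2`. -/
lemma integral_euclideanUnitBall_mul_coord {N : ℕ} {v : (Fin N → ℝ) → ℝ} (hv : ContDiff ℝ 1 v)
    (i : Fin N) :
    ∫ x in euclideanUnitBall N, v x * x i =
      ∫ x in euclideanUnitBall N, (1 - ∑ j, (x j) ^ 2) / 2 * fderiv ℝ v x (Pi.single i 1) := by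
  let q : (Fin N → ℝ) → ℝ := fun x => (1 - ∑ j, (x j) ^ 2) / 2
  have hq : ContDiff ℝ 1 q := by fun_prop
  let χ : ContDiffBump (0 : Fin N → ℝ) := ⟨2, 3, by norm_num, by norm_num⟩
  have hχ : ContDiff ℝ 1 χ := χ.contDiff
  have hone : ∀ x ∈ euclideanUnitBall N, χ =ᶠ[𝓝 x] 1 := fun x hx =>
    χ.eventuallyEq_one_of_mem_ball
      (Metric.closedBall_subset_ball (by norm_num) (euclideanUnitBall_subset_closedBall N hx))
  obtain ⟨C, hC⟩ := (hχ.mul hv).lipschitzWith_of_hasCompactSupport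
    (χ.hasCompactSupport.mul_right (f' := v)) one_ne_zero
  obtain ⟨D, hD⟩ := (hχ.mul hq).lipschitzWith_of_hasCompactSupport
    (χ.hasCompactSupport.mul_right (f' := q)) one_ne_zero
  let g : (Fin N → ℝ) → ℝ := fun x => max (χ x * q x) 0
  have hg : LipschitzWith D g := hD.max_const 0
  have hgs : HasCompactSupport g :=
    (χ.hasCompactSupport.mul_right (f' := q)).comp_left (g := fun t : ℝ => max t 0) (by simp)
  have hg_out : ∀ x, q x ≤ 0 → g x = 0 := fun x hx =>
    max_eq_right (mul_nonpos_of_nonneg_of_nonpos χ.nonneg hx)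
  have hg_in : ∀ x ∈ euclideanUnitBall N, g x = q x := by
    intro x hx
    have h1 : χ x = 1 := (hone x hx).eq_of_nhds
    have h2 : 0 ≤ q x := div_nonneg (sub_nonneg.2 hx) zero_le_two
    simp [g, h1, h2]
  have hq' : ∀ x, HasLineDerivAt ℝ q (x i) x (-Pi.single i 1) := by
    intro x
    have h : HasDerivAt (fun t : ℝ => (1 - ∑ j, (x j + t * (-Pi.single i 1 : Fin N → ℝ) j) ^ 2) / 2)
        ((0 - ∑ j, (2 : ℕ) * (x j + 0 * (-Pi.single i 1 : Fin N → ℝ) j) ^ (2 - 1) *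
          (0 + 1 * (-Pi.single i 1 : Fin N → ℝ) j)) / 2) 0 := by
      refine (HasDerivAt.sub (hasDerivAt_const _ _)
        (HasDerivAt.fun_sum fun j _ => HasDerivAt.fun_pow ?_ 2)).div_const 2
      exact (hasDerivAt_const _ _).add ((hasDerivAt_id _).mul_const _)
    have hval : ((0 - ∑ j, (2 : ℕ) * (x j + 0 * (-Pi.single i 1 : Fin N → ℝ) j) ^ (2 - 1) *
          (0 + 1 * (-Pi.single i 1 : Fin N → ℝ) j)) / 2) = x i := by
      simp [Pi.single_apply]
    rw [hval] at h
    exact h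
  have hmeas : MeasurableSet (euclideanUnitBall N) :=
    (isCompact_euclideanUnitBall N).isClosed.measurableSet
  have key := LipschitzWith.integral_lineDeriv_mul_eq (μ := volume) hC hg hgs (Pi.single i 1)
  rw [← integral_indicator hmeas, ← integral_indicator hmeas]
  refine Eq.trans ?_ (key.symm.trans ?_)
  · refine integral_congr_ae ?_
    have hae : ∀ᵐ x : Fin N → ℝ, ∑ j, (x j) ^ 2 ≠ 1 :=
      measure_eq_zero_iff_ae_notMem.1 (volume_euclideanUnitSphere i.pos)
    filter_upwards [hae] with x hx
    have hcont : Continuous fun y : Fin N → ℝ => ∑ j, (y j) ^ 2 := by fun_prop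
    rcases hx.lt_or_gt with hlt | hgt
    · have hxB : x ∈ euclideanUnitBall N := hlt.le
      have hgq : g =ᶠ[𝓝 x] q := by
        filter_upwards [hcont.continuousAt.eventually_lt continuousAt_const hlt] with y hy
        exact hg_in y (le_of_lt hy)
      have h1 : χ x = 1 := (hone x hxB).eq_of_nhds
      rw [Set.indicator_of_mem hxB, hgq.lineDeriv_eq, (hq' x).lineDeriv, Pi.mul_apply, h1]
      ring
    · have hxB : x ∉ euclideanUnitBall N := not_le.2 hgt
      have hg0 : g =ᶠ[𝓝 x] fun _ => 0 := by
        filter_upwards [continuousAt_const.eventually_lt hcont.continuousAt hgt] with y hy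
        exact hg_out y (by simp only [q]; linarith)
      rw [Set.indicator_of_notMem hxB, hg0.lineDeriv_eq]
      simp [lineDeriv]
  · refine integral_congr_ae (Eventually.of_forall fun x => ?_)
    by_cases hxB : x ∈ euclideanUnitBall N
    · have hfv : (χ : (Fin N → ℝ) → ℝ) * v =ᶠ[𝓝 x] v := by
        filter_upwards [hone x hxB] with y hy
        simp [hy]
      simp only [Set.indicator_of_mem hxB, hfv.lineDeriv_eq, hg_in x hxB]
      rw [((hv.differentiable one_ne_zero) x).lineDeriv_eq_fderiv, mul_comm]
    · have hgx : g x = 0 := by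
        refine hg_out x ?_
        have : 1 < ∑ j, (x j) ^ 2 := not_le.1 hxB
        simp only [q]; linarith
      simp only [Set.indicator_of_notMem hxB, hgx, mul_zero]

/-- A diagonal change of variables mapping the unit ball to an ellipsoid. -/
lemma integral_ellipsoid_eq {N : ℕ} {b : Fin N → ℝ} (hb : ∀ j, b j ≠ 0)
    (u : (Fin N → ℝ) → ℝ) :
    ∫ x in {x : Fin N → ℝ | ∑ j, (x j) ^ 2 / (b j) ^ 2 ≤ 1}, u x =
      |∏ j, b j| * ∫ y in euclideanUnitBall N, u (b * y) := by
  have hdet : (Matrix.diagonal b).det ≠ 0 := by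
    rw [Matrix.det_diagonal]; exact Finset.prod_ne_zero_iff.2 fun j _ => hb j
  have hfun : (Matrix.toLin' (Matrix.diagonal b) : (Fin N → ℝ) → Fin N → ℝ) = fun y => b * y := by
    ext y j
    simp [Matrix.mulVec_diagonal]
  let e : (Fin N → ℝ) ≃ₜ (Fin N → ℝ) := 
    Homeomorph.piCongrRight fun j => Homeomorph.mulLeft₀ (b j) (hb j)
  have he : (fun y => b * y) = e := rfl
  have hpre : e ⁻¹' {x : Fin N → ℝ | ∑ j, (x j) ^ 2 / (b j) ^ 2 ≤ 1} = euclideanUnitBall N := by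
    ext y
    have : ∀ j, (e y j) ^ 2 / (b j) ^ 2 = (y j) ^ 2 := by
      intro j
      have := hb j
      change (b j * y j) ^ 2 / (b j) ^ 2 = (y j) ^ 2
      field_simp
    simp [this, euclideanUnitBall]
  conv_lhs => rw [← Real.smul_map_diagonal_volume_pi hdet]
  rw [Measure.restrict_smul, integral_smul_measure, hfun, he,
    e.measurableEmbedding.setIntegral_map, hpre, Matrix.det_diagonal,
    ENNReal.toReal_ofReal (abs_nonneg _), smul_eq_mul]
  rfl

lemma average_ellipsoid_eq {N : ℕ} {b : Fin N → ℝ} (hb : ∀ j, b j ≠ 0)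
    (u : (Fin N → ℝ) → ℝ) :
    (1 / (volume {x : Fin N → ℝ | ∑ j, (x j) ^ 2 / (b j) ^ 2 ≤ 1}).toReal) *
        ∫ x in {x : Fin N → ℝ | ∑ j, (x j) ^ 2 / (b j) ^ 2 ≤ 1}, u x =
      (1 / (volume (euclideanUnitBall N)).toReal) *
        ∫ y in euclideanUnitBall N, u (b * y) := by
  have hvol := integral_ellipsoid_eq hb (fun _ => 1)
  simp only [integral_const, smul_eq_mul, mul_one, Measure.real, Measure.restrict_apply_univ]
    at hvol
  have hd : |∏ j, b j| ≠ 0 := abs_ne_zero.2 (Finset.prod_ne_zero_iff.2 fun j _ => hb j)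
  rw [integral_ellipsoid_eq hb u, hvol]
  field_simp

/-- Differentiation under the integral sign over a compact set. -/
lemma hasDerivAt_setIntegral_of_continuousOn {X : Type*} [TopologicalSpace X] [T2Space X]
    [MeasurableSpace X] [BorelSpace X] [SecondCountableTopology X]
    {μ : Measure X} [IsFiniteMeasureOnCompacts μ] {K : Set X} (hK : IsCompact K) {s : Set ℝ}
    (hs : IsOpen s) {F F' : ℝ → X → ℝ} (hF : ∀ t ∈ s, ContinuousOn (F t) K)
    (hF' : ContinuousOn (Function.uncurry F') (s ×ˢ K))
    (hderiv : ∀ t ∈ s, ∀ x ∈ K, HasDerivAt (F · x) (F' t x) t) {t : ℝ} (ht : t ∈ s) :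
    HasDerivAt (fun t => ∫ x in K, F t x ∂μ) (∫ x in K, F' t x ∂μ) t := by
  obtain ⟨ε, hε, hsub⟩ := Metric.nhds_basis_closedBall.mem_iff.1 (hs.mem_nhds ht)
  obtain ⟨C, hC⟩ := ((isCompact_closedBall t ε).prod hK).exists_bound_of_continuousOn
    (hF'.mono (Set.prod_mono_left hsub))
  have hKm := hK.isClosed.measurableSet
  refine (hasDerivAt_integral_of_dominated_loc_of_deriv_le (μ := μ.restrict K) (bound := fun _ => C)
    (Metric.closedBall_mem_nhds t hε) ?_ ((hF t ht).integrableOn_compact hK) ?_ ?_ ?_ ?_).2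
  · filter_upwards [hs.mem_nhds ht] with r hr
    exact (hF r hr).aestronglyMeasurable hKm
  · exact (hF'.comp (f := fun x => (t, x)) (by fun_prop) fun x hx => ⟨ht, hx⟩).aestronglyMeasurable hKm
  · exact (ae_restrict_mem hKm).mono fun x hx r hr => hC (r, x) ⟨hr, hx⟩
  · exact integrableOn_const hK.measure_ne_top
  · exact (ae_restrict_mem hKm).mono fun x hx r hr => hderiv r (hsub hr) x hx

lemma fderiv_apply_eq_sum {N : ℕ} (u : (Fin N → ℝ) → ℝ) (x w : Fin N → ℝ) :
    fderiv ℝ u x w = ∑ j, w j * fderiv ℝ u x (Pi.single j 1) := by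
  conv_lhs => rw [← Finset.univ_sum_single w, map_sum]
  refine Finset.sum_congr rfl fun j _ => ?_
  rw [← smul_eq_mul, ← map_smul, ← Pi.single_smul, smul_eq_mul, mul_one]

/-- The derivative of the mean over confocal ellipsoids is proportional to an integral of the
Laplacian, hence vanishes for harmonic functions. -/
lemma integral_euclideanUnitBall_deriv_eq_zero {N : ℕ} {u : (Fin N → ℝ) → ℝ}
    (hu : ContDiff ℝ 2 u) (hharm : ∀ x, lap u x = 0) {b : Fin N → ℝ} (hb : ∀ j, b j ≠ 0) :
    ∫ y in euclideanUnitBall N, fderiv ℝ u (b * y) (fun j => 1 / (2 * b j) * y j) = 0 := by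
  have hK := isCompact_euclideanUnitBall N
  let p : Fin N → (Fin N → ℝ) → ℝ := fun j x => fderiv ℝ u x (Pi.single j 1)
  have hp : ∀ j, ContDiff ℝ 1 (p j) := fun j =>
    (hu.fderiv_right (by norm_num)).clm_apply contDiff_const
  have hcomp : ∀ j, ContDiff ℝ 1 (fun y => p j (b * y)) := fun j =>
    (hp j).comp (contDiff_const.mul contDiff_id)
  have hfd : ∀ j y, fderiv ℝ (fun y => p j (b * y)) y (Pi.single j 1) =
      b j * fderiv ℝ (p j) (b * y) (Pi.single j 1) := by
    intro j y
    have h1 : HasFDerivAt (fun y : Fin N → ℝ => b * y)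
        (ContinuousLinearMap.mul ℝ (Fin N → ℝ) b) y :=
      (ContinuousLinearMap.mul ℝ (Fin N → ℝ) b).hasFDerivAt
    have h2 := (((hp j).differentiable one_ne_zero) (b * y)).hasFDerivAt.comp y h1
    change fderiv ℝ (p j ∘ fun y => b * y) y (Pi.single j 1) = _
    rw [h2.fderiv]
    have h3 : b * Pi.single j 1 = b j • (Pi.single j 1 : Fin N → ℝ) := by
      ext k
      by_cases hk : k = j
      · subst hk; simp
      · simp [hk]
    simp [h3]
  have hpc : ∀ j, Continuous fun y => fderiv ℝ (fun y => p j (b * y)) y (Pi.single j 1) :=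
    fun j => ((hcomp j).continuous_fderiv one_ne_zero).clm_apply continuous_const
  calc ∫ y in euclideanUnitBall N, fderiv ℝ u (b * y) (fun j => 1 / (2 * b j) * y j)
      = ∫ y in euclideanUnitBall N, ∑ j, 1 / (2 * b j) * (p j (b * y) * y j) := by
        congr 1 with y
        rw [fderiv_apply_eq_sum]
        exact Finset.sum_congr rfl fun j _ => by ring
    _ = ∑ j, 1 / (2 * b j) * ∫ y in euclideanUnitBall N, p j (b * y) * y j := by
        rw [integral_finsetSum]
        · simp_rw [integral_const_mul]
        · intro j _
          have := (hcomp j).continuous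
          exact ContinuousOn.integrableOn_compact hK (Continuous.continuousOn (by fun_prop))
    _ = ∑ j, 1 / (2 * b j) * ∫ y in euclideanUnitBall N, (1 - ∑ k, (y k) ^ 2) / 2 *
          fderiv ℝ (fun y => p j (b * y)) y (Pi.single j 1) := by
        simp_rw [integral_euclideanUnitBall_mul_coord (hcomp _)]
    _ = ∫ y in euclideanUnitBall N, ∑ j, 1 / (2 * b j) * ((1 - ∑ k, (y k) ^ 2) / 2 *
          fderiv ℝ (fun y => p j (b * y)) y (Pi.single j 1)) := by
        rw [integral_finsetSum]
        · simp_rw [integral_const_mul]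
        · intro j _
          have := hpc j
          exact ContinuousOn.integrableOn_compact hK (Continuous.continuousOn (by fun_prop))
    _ = ∫ y in euclideanUnitBall N, (1 - ∑ k, (y k) ^ 2) / 4 * lap u (b * y) := by
        congr 1 with y
        rw [lap, Finset.mul_sum]
        refine Finset.sum_congr rfl fun j _ => ?_
        rw [hfd]
        have := hb j
        change _ = _ * fderiv ℝ (p j) (b * y) (Pi.single j 1)
        field_simp
        ring
    _ = 0 := by simp [hharm]

/-- **MacLaurin's theorem** (Theorem 2.2): the average of an entire harmonic function over
the confocal family of ellipsoids `Ω_λ = {x : Σ xⱼ²/(aⱼ²+λ) ≤ 1}`, `λ > −a_N²`, is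
independent of `λ`. -/
theorem maclaurin_mean_value_confocal_ellipsoids
    (N : ℕ) (hN : 2 ≤ N) (a : Fin N → ℝ) (hpos : ∀ j, 0 < a j)
    (hdecr : ∀ i j : Fin N, i ≤ j → a j ≤ a i)
    (u : (Fin N → ℝ) → ℝ) (hu : ContDiff ℝ 2 u) (hharm : ∀ x, lap u x = 0)
    (lam₁ lam₂ : ℝ)
    (h₁ : -(a ⟨N - 1, by omega⟩) ^ 2 < lam₁) (h₂ : -(a ⟨N - 1, by omega⟩) ^ 2 < lam₂) :
    (1 / (volume {x : Fin N → ℝ | ∑ j, (x j) ^ 2 / ((a j) ^ 2 + lam₁) ≤ 1}).toReal) *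
        ∫ x in {x : Fin N → ℝ | ∑ j, (x j) ^ 2 / ((a j) ^ 2 + lam₁) ≤ 1}, u x =
      (1 / (volume {x : Fin N → ℝ | ∑ j, (x j) ^ 2 / ((a j) ^ 2 + lam₂) ≤ 1}).toReal) *
        ∫ x in {x : Fin N → ℝ | ∑ j, (x j) ^ 2 / ((a j) ^ 2 + lam₂) ≤ 1}, u x := by
  set m := (a ⟨N - 1, by omega⟩) ^ 2
  have hs : ∀ t ∈ Set.Ioi (-m), ∀ j, 0 < (a j) ^ 2 + t := by
    intro t ht j
    have h1 : a ⟨N - 1, by omega⟩ ≤ a j := hdecr _ _ (Fin.mk_le_mk.2 (by omega) : j ≤ ⟨N - 1, _⟩)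
    have h2 : m ≤ (a j) ^ 2 := pow_le_pow_left₀ (hpos _).le h1 2
    have h3 : -m < t := ht
    linarith
  let b : ℝ → Fin N → ℝ := fun t j => √((a j) ^ 2 + t)
  have hb : ∀ t ∈ Set.Ioi (-m), ∀ j, b t j ≠ 0 := fun t ht j => (Real.sqrt_pos.2 (hs t ht j)).ne'
  have hbc : Continuous b := by fun_prop
  have havg : ∀ t ∈ Set.Ioi (-m),
      (1 / (volume {x : Fin N → ℝ | ∑ j, (x j) ^ 2 / ((a j) ^ 2 + t) ≤ 1}).toReal) *
        ∫ x in {x : Fin N → ℝ | ∑ j, (x j) ^ 2 / ((a j) ^ 2 + t) ≤ 1}, u x =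
      (1 / (volume (euclideanUnitBall N)).toReal) *
        ∫ y in euclideanUnitBall N, u (b t * y) := by
    intro t ht
    rw [← average_ellipsoid_eq (hb t ht)]
    have h : ∀ j, b t j ^ 2 = (a j) ^ 2 + t := fun j => Real.sq_sqrt (hs t ht j).le
    simp_rw [h]
  rw [havg _ h₁, havg _ h₂]
  congr 1
  have hderiv : ∀ t ∈ Set.Ioi (-m),
      HasDerivAt (fun t => ∫ y in euclideanUnitBall N, u (b t * y)) 0 t := by
    intro t ht
    rw [← integral_euclideanUnitBall_deriv_eq_zero hu hharm (hb t ht)]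
    refine hasDerivAt_setIntegral_of_continuousOn (isCompact_euclideanUnitBall N) isOpen_Ioi
      (F := fun t y => u (b t * y))
      (F' := fun t y => fderiv ℝ u (b t * y) fun j => 1 / (2 * b t j) * y j) ?_ ?_ ?_ ht
    · intro r _
      have := hu.continuous
      fun_prop
    · have h1 : Continuous fun z : ℝ × (Fin N → ℝ) => fderiv ℝ u (b z.1 * z.2) :=
        (hu.continuous_fderiv two_ne_zero).comp (by fun_prop)
      refine h1.continuousOn.clm_apply (continuousOn_pi.2 fun j => ?_)
      refine ContinuousOn.mul (ContinuousOn.div continuousOn_const ?_ ?_) ?_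
      · exact Continuous.continuousOn (by fun_prop)
      · exact fun z hz => mul_ne_zero two_ne_zero (hb z.1 hz.1 j)
      · exact Continuous.continuousOn (by fun_prop)
    · intro r hr y _
      have h1 : HasDerivAt (fun r => b r * y) (fun j => 1 / (2 * b r j) * y j) r := by
        refine hasDerivAt_pi.2 fun j => ?_
        have := (((hasDerivAt_id r).const_add ((a j) ^ 2)).sqrt (hs r hr j).ne').mul_const (y j)
        exact this
      exact (((hu.differentiable two_ne_zero) (b r * y)).hasFDerivAt).comp_hasDerivAt r h1
  exact isOpen_Ioi.is_const_of_deriv_eq_zero isPreconnected_Ioi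
    (fun t ht => (hderiv t ht).differentiableAt.differentiableWithinAt)
    (fun t ht => (hderiv t ht).deriv) h₁ h₂
end

section
/- Let N ≥ 1, let m ≥ 0 be an integer, let B be the closed unit ball of ℝ^N, and for t ∈ ℂ^N define P(t) = ∫_B (Σ_{k=1}^N t_k x_k)^m dx (integration with respect to Lebesgue measure on B). Then P(t) depends only on Σ_{k=1}^N t_k²: for all s, t ∈ ℂ^N with Σ_{k=1}^N s_k² = Σ_{k=1}^N t_k², one has P(s) = P(t). -/
open MeasureTheory

namespace BallMoment

variable {ι : Type*} [Fintype ι]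

/-- The `m`-th moment of the complex linear form `x ↦ ∑ tₖ xₖ` over the Euclidean unit ball. -/
noncomputable def ballMoment (m : ℕ) (t : ι → ℂ) : ℂ :=
  ∫ x in Metric.closedBall (0 : EuclideanSpace ℝ ι) 1, (∑ k, t k * (x k : ℂ)) ^ m

theorem setIntegral_eq_ballMoment (m : ℕ) (t : ι → ℂ) :
    (∫ x in {x : ι → ℝ | ∑ k, (x k) ^ 2 ≤ 1}, (∑ k, t k * (x k : ℂ)) ^ m) = ballMoment m t := by
  rw [ballMoment, ← (PiLp.volume_preserving_toLp ι).setIntegral_preimage_emb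
    (MeasurableEquiv.toLp 2 _).measurableEmbedding]
  congr 2
  ext x
  simp [EuclideanSpace.norm_eq]

theorem exists_eval_eq_ballMoment (m : ℕ) :
    ∃ p : MvPolynomial ι ℂ, ∀ t, MvPolynomial.eval t p = ballMoment m t := by
  classical
  refine ⟨∑ p : Fin m → ι, (∏ i, MvPolynomial.X (p i)) *
    MvPolynomial.C (∫ x in Metric.closedBall (0 : EuclideanSpace ℝ ι) 1,
      ∏ i, (x (p i) : ℂ)), fun t => ?_⟩
  simp only [ballMoment, Finset.sum_pow', Fintype.piFinset_univ, Finset.prod_mul_distrib]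
  rw [integral_finsetSum]
  · simp [integral_const_mul, map_sum, map_prod]
  · intro p _
    refine ContinuousOn.integrableOn_compact (isCompact_closedBall _ _) ?_
    fun_prop

theorem ballMoment_smul (m : ℕ) (a : ℂ) (t : ι → ℂ) :
    ballMoment m (a • t) = a ^ m * ballMoment m t := by
  simp only [ballMoment, Pi.smul_apply, smul_eq_mul, mul_assoc, ← Finset.mul_sum, mul_pow,
    integral_const_mul]

theorem ballMoment_ofReal (m : ℕ) (u : EuclideanSpace ℝ ι) :
    ballMoment m (fun k => (u k : ℂ)) =
      ∫ x in Metric.closedBall (0 : EuclideanSpace ℝ ι) 1, ((inner ℝ u x : ℝ) : ℂ) ^ m := by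
  simp [ballMoment, PiLp.inner_apply, mul_comm]

theorem ballMoment_ofReal_eq_of_norm_eq (m : ℕ) {u v : EuclideanSpace ℝ ι} (h : ‖u‖ = ‖v‖) :
    ballMoment m (fun k => (u k : ℂ)) = ballMoment m (fun k => (v k : ℂ)) := by
  let R : EuclideanSpace ℝ ι ≃ₗᵢ[ℝ] EuclideanSpace ℝ ι := (ℝ ∙ (u - v))ᗮ.reflection
  have hR : R u = v := Submodule.reflection_sub h
  rw [eq_comm, ballMoment_ofReal, ballMoment_ofReal, ← R.measurePreserving.setIntegral_preimage_emb
    R.toMeasurableEquiv.measurableEmbedding]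
  simp [← hR]

theorem exists_ballMoment_ofReal_eq (m : ℕ) [Nonempty ι] :
    ∃ (c : ℂ) (n : ℕ), ∀ u : EuclideanSpace ℝ ι,
      ballMoment m (fun k => (u k : ℂ)) = c * (∑ k, (u k : ℂ) ^ 2) ^ n := by
  classical
  rcases m.even_or_odd' with ⟨n, rfl | rfl⟩
  · let e : EuclideanSpace ℝ ι := EuclideanSpace.single (Classical.arbitrary ι) 1
    refine ⟨ballMoment (2 * n) (fun k => (e k : ℂ)), n, fun u => ?_⟩
    have h : ‖u‖ = ‖‖u‖ • e‖ := by simp [e, norm_smul]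
    have hs : (fun k => (((‖u‖ • e) k : ℝ) : ℂ)) = (‖u‖ : ℂ) • fun k => (e k : ℂ) := by
      ext k; simp
    have hn : (∑ k, (u k : ℂ) ^ 2) = (‖u‖ : ℂ) ^ 2 := by
      exact_mod_cast (EuclideanSpace.real_norm_sq_eq u).symm
    rw [ballMoment_ofReal_eq_of_norm_eq _ h, hs, ballMoment_smul, hn, pow_mul, mul_comm]
  · refine ⟨0, 0, fun u => ?_⟩
    have h := ballMoment_ofReal_eq_of_norm_eq (2 * n + 1) (norm_neg u)
    have hs : (fun k => (((-u) k : ℝ) : ℂ)) = (-1 : ℂ) • fun k => (u k : ℂ) := by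
      ext k; simp
    rw [hs, ballMoment_smul, Odd.neg_one_pow ⟨n, rfl⟩, neg_one_mul] at h
    simpa using self_eq_neg.mp h.symm

theorem exists_ballMoment_eq (m : ℕ) [Nonempty ι] :
    ∃ (c : ℂ) (n : ℕ), ∀ t : ι → ℂ, ballMoment m t = c * (∑ k, t k ^ 2) ^ n := by
  obtain ⟨c, n, h⟩ := exists_ballMoment_ofReal_eq (ι := ι) m
  obtain ⟨p, hp⟩ := exists_eval_eq_ballMoment (ι := ι) m
  refine ⟨c, n, fun t => ?_⟩
  have hpq : p = MvPolynomial.C c * (∑ k, MvPolynomial.X k ^ 2) ^ n := by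
    refine MvPolynomial.funext_set (fun _ => Set.range ((↑) : ℝ → ℂ))
      (fun _ => Set.infinite_range_of_injective Complex.ofReal_injective) fun x hx => ?_
    choose u hu using fun k => hx k (Set.mem_univ k)
    obtain rfl : (fun k => (u k : ℂ)) = x := funext hu
    simpa [hp] using h (WithLp.toLp 2 u)
  simp [← hp, hpq]

end BallMoment

/-- The Assertion in the algebraic proof of MacLaurin's theorem:
`P(t) = ∫_B (Σ tₖ xₖ)^m dx`, integrated over the unit ball `B` of `ℝᴺ`, depends only on
`Σ tₖ²` for `t ∈ ℂᴺ`. -/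
theorem ball_moment_polynomial_depends_only_on_sum_of_squares
    (N : ℕ) (hN : 1 ≤ N) (m : ℕ) (s t : Fin N → ℂ)
    (hst : (∑ k, (s k) ^ 2) = ∑ k, (t k) ^ 2) :
    (∫ x in {x : Fin N → ℝ | ∑ k, (x k) ^ 2 ≤ 1}, (∑ k, s k * (x k : ℂ)) ^ m) =
      ∫ x in {x : Fin N → ℝ | ∑ k, (x k) ^ 2 ≤ 1}, (∑ k, t k * (x k : ℂ)) ^ m := by
  have : Nonempty (Fin N) := ⟨⟨0, hN⟩⟩
  obtain ⟨c, n, h⟩ := BallMoment.exists_ballMoment_eq (ι := Fin N) m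
  rw [BallMoment.setIntegral_eq_ballMoment, BallMoment.setIntegral_eq_ballMoment, h, h, hst]
end

section
/- Let N ≥ 3 and a_1 > a_2 > ... > a_N > 0. Let Ω = {x ∈ ℝ^N : Σ_{j=1}^N x_j²/a_j² ≤ 1}, let E = {y ∈ ℝ^N : y_N = 0, Σ_{j=1}^{N−1} y_j²/(a_j² − a_N²) ≤ 1} be the focal ellipsoid, and let μ be the measure on E given by dμ(y) = 2(Π_{j=1}^N a_j)(Π_{j=1}^{N−1}(a_j² − a_N²))^{−1/2}(1 − Σ_{j=1}^{N−1} y_j²/(a_j² − a_N²))^{1/2} dy′, where dy′ is (N−1)-dimensional Lebesgue measure on the hyperplane {y_N = 0}, restricted to E. Then for every x ∈ ℝ^N \ closure(Ω): ∫_Ω |x − y|^{2−N} dy = ∫_E |x − y|^{2−N} dμ(y). -/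
open MeasureTheory

/-- The closed Euclidean unit ball, as a subset of the product space `Fin n → ℝ`. -/
def euclideanBall (n : ℕ) : Set (Fin n → ℝ) := {u | ∑ j, u j ^ 2 ≤ 1}

lemma isClosed_euclideanBall (n : ℕ) : IsClosed (euclideanBall n) :=
  isClosed_le (by fun_prop) continuous_const

lemma isCompact_euclideanBall (n : ℕ) : IsCompact (euclideanBall n) := by
  refine Metric.isCompact_of_isClosed_isBounded (isClosed_euclideanBall n) ?_
  refine (Metric.isBounded_closedBall (x := (0 : Fin n → ℝ)) (r := 1)).subset fun u hu => ?_
  rw [mem_closedBall_zero_iff, pi_norm_le_iff_of_nonneg zero_le_one]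
  intro i
  rw [Real.norm_eq_abs, ← sq_le_one_iff_abs_le_one]
  exact (Finset.single_le_sum (f := fun j => u j ^ 2) (fun j _ => sq_nonneg _)
    (Finset.mem_univ i)).trans hu

lemma insertNth_mem_euclideanBall {n : ℕ} (j : Fin (n + 1)) (s : ℝ) (v : Fin n → ℝ) :
    j.insertNth (α := fun _ => ℝ) s v ∈ euclideanBall (n + 1) ↔
      s ^ 2 ≤ 1 - ∑ i, v i ^ 2 := by
  simp only [euclideanBall, Set.mem_ofPred_eq, Fin.sum_univ_succAbove _ j,
    Fin.insertNth_apply_same, Fin.insertNth_apply_succAbove]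
  constructor <;> intro h <;> linarith

/-- Fubini's theorem for the unit ball, slicing parallel to the `j`-th coordinate axis. -/
lemma setIntegral_euclideanBall_succ {n : ℕ} (j : Fin (n + 1)) {f : (Fin (n + 1) → ℝ) → ℝ}
    (hf : IntegrableOn f (euclideanBall (n + 1))) :
    ∫ u in euclideanBall (n + 1), f u = ∫ v in euclideanBall n,
      ∫ s in (-√(1 - ∑ i, v i ^ 2))..√(1 - ∑ i, v i ^ 2), f (j.insertNth s v) := by
  have hB := (isClosed_euclideanBall (n + 1)).measurableSet
  have hmp := (volume_preserving_piFinSuccAbove (fun _ : Fin (n + 1) => ℝ) j).symm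
  rw [← integral_indicator hB, ← integral_indicator (isClosed_euclideanBall n).measurableSet,
    ← hmp.integral_comp', Measure.volume_eq_prod, integral_prod_symm]
  · congr 1
    ext v
    by_cases hv : v ∈ euclideanBall n
    · have h0 : 0 ≤ 1 - ∑ i, v i ^ 2 := sub_nonneg.2 hv
      rw [Set.indicator_of_mem hv, intervalIntegral.integral_of_le
        (by linarith [Real.sqrt_nonneg (1 - ∑ i, v i ^ 2)]), ← integral_Icc_eq_integral_Ioc,
        ← integral_indicator measurableSet_Icc]
      congr 1
      ext s
      have : s ∈ Set.Icc (-√(1 - ∑ i, v i ^ 2)) (√(1 - ∑ i, v i ^ 2)) ↔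
          j.insertNth (α := fun _ => ℝ) s v ∈ euclideanBall (n + 1) := by
        rw [insertNth_mem_euclideanBall, ← Real.sqrt_le_sqrt_iff h0, Real.sqrt_sq_eq_abs, abs_le,
          Set.mem_Icc]
      by_cases hs : j.insertNth (α := fun _ => ℝ) s v ∈ euclideanBall (n + 1)
      · rw [Set.indicator_of_mem (this.2 hs)]
        exact Set.indicator_of_mem hs f
      · rw [Set.indicator_of_notMem (mt this.1 hs)]
        exact Set.indicator_of_notMem hs f
    · rw [Set.indicator_of_notMem hv]
      refine integral_eq_zero_of_ae (Filter.Eventually.of_forall fun s => ?_)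
      refine Set.indicator_of_notMem (fun hs => hv ?_) f
      have := (insertNth_mem_euclideanBall j s v).1 hs
      have h2 : ∑ i, v i ^ 2 ≤ 1 := by nlinarith [sq_nonneg s]
      exact h2
  · have := (hmp.integrable_comp_emb (MeasurableEquiv.measurableEmbedding _)).2
      (hf.integrable_indicator hB)
    exact this

/-- Integration by parts on the unit ball in the direction of the `j`-th coordinate. -/
lemma setIntegral_euclideanBall_mul_eq {n : ℕ} (j : Fin (n + 1)) {V V' : (Fin (n + 1) → ℝ) → ℝ}
    (hV : ContinuousOn V (euclideanBall (n + 1))) (hV' : ContinuousOn V' (euclideanBall (n + 1)))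
    (hd : ∀ s v, j.insertNth (α := fun _ => ℝ) s v ∈ euclideanBall (n + 1) →
      HasDerivAt (fun s => V (j.insertNth s v)) (V' (j.insertNth s v)) s) :
    ∫ u in euclideanBall (n + 1), u j * V u =
      ∫ u in euclideanBall (n + 1), (1 - ∑ i, u i ^ 2) / 2 * V' u := by
  have hK := isCompact_euclideanBall (n + 1)
  rw [setIntegral_euclideanBall_succ j, setIntegral_euclideanBall_succ j]
  rotate_left
  · exact ContinuousOn.integrableOn_compact hK (by fun_prop)
  · exact ContinuousOn.integrableOn_compact hK (by fun_prop)
  refine setIntegral_congr_fun (isClosed_euclideanBall n).measurableSet fun v hv => ?_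
  have h0 : 0 ≤ 1 - ∑ i, v i ^ 2 := sub_nonneg.2 hv
  set r := √(1 - ∑ i, v i ^ 2) with hr
  have hr2 : r ^ 2 = 1 - ∑ i, v i ^ 2 := Real.sq_sqrt h0
  have hr0 : 0 ≤ r := Real.sqrt_nonneg _
  have hmem : ∀ s ∈ Set.uIcc (-r) r, j.insertNth (α := fun _ => ℝ) s v ∈ euclideanBall (n + 1) := by
    intro s hs
    rw [Set.uIcc_of_le (by linarith)] at hs
    rw [insertNth_mem_euclideanBall, ← hr2]
    exact sq_le_sq' hs.1 hs.2
  have hcont : ContinuousOn (fun s => V' (j.insertNth s v)) (Set.uIcc (-r) r) :=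
    hV'.comp (Continuous.continuousOn (by fun_prop)) hmem
  have key := intervalIntegral.integral_mul_deriv_eq_deriv_mul (a := -r) (b := r)
    (u := fun s => (r ^ 2 - s ^ 2) / 2) (u' := fun s => -s)
    (v := fun s => V (j.insertNth s v)) (v' := fun s => V' (j.insertNth s v))
    (fun s _ => by
      have := (((hasDerivAt_id s).pow 2).const_sub (r ^ 2)).div_const 2
      refine this.congr_deriv ?_
      simp only [id_eq, Nat.cast_ofNat, Nat.add_one_sub_one, pow_one, mul_one]
      ring)
    (fun s hs => hd s v (hmem s hs)) (Continuous.intervalIntegrable (by fun_prop) _ _)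
    hcont.intervalIntegrable
  simp only [Fin.sum_univ_succAbove _ j, Fin.insertNth_apply_same, Fin.insertNth_apply_succAbove]
  rw [show (fun s => (1 - (s ^ 2 + ∑ i, v i ^ 2)) / 2 * V' (j.insertNth s v)) =
    fun s => (r ^ 2 - s ^ 2) / 2 * V' (j.insertNth s v) by
      ext s; rw [hr2]; ring, key]
  simp

lemma setIntegral_ellipsoid_eq {n : ℕ} {d : Fin n → ℝ} (hd : ∀ j, 0 < d j)
    (f : (Fin n → ℝ) → ℝ) :
    ∫ y in {y : Fin n → ℝ | ∑ j, y j ^ 2 / d j ^ 2 ≤ 1}, f y =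
      (∏ j, d j) * ∫ u in euclideanBall n, f (fun j => d j * u j) := by
  have hS : MeasurableSet {y : Fin n → ℝ | ∑ j, y j ^ 2 / d j ^ 2 ≤ 1} :=
    (isClosed_le (by fun_prop) continuous_const).measurableSet
  have hdet : (Matrix.diagonal d).det ≠ 0 := by
    rw [Matrix.det_diagonal]; exact Finset.prod_ne_zero_iff.2 fun j _ => (hd j).ne'
  have hp : 0 ≤ ∏ j, d j := Finset.prod_nonneg fun j _ => (hd j).le
  have hmap := Real.smul_map_diagonal_volume_pi hdet
  rw [Matrix.det_diagonal, abs_of_nonneg hp] at hmap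
  have hemb : MeasurableEmbedding (Matrix.toLin' (Matrix.diagonal d)) := by
    have : Function.Injective (Matrix.toLin' (Matrix.diagonal d)) := by
      intro u v huv
      ext j
      have := congrFun huv j
      simpa [Matrix.mulVec_diagonal, (hd j).ne'] using this
    exact (LinearMap.continuous_of_finiteDimensional _).measurableEmbedding this
  conv_lhs => rw [← hmap]
  rw [Measure.restrict_smul, integral_smul_measure, hemb.setIntegral_map,
    ENNReal.toReal_ofReal hp, smul_eq_mul]
  congr 2
  · congr 1
    ext u
    simp only [euclideanBall, Set.mem_preimage, Set.mem_ofPred_eq, Matrix.toLin'_apply,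
      Matrix.mulVec_diagonal]
    have : ∀ j, (d j * u j) ^ 2 / d j ^ 2 = u j ^ 2 := fun j => by
      have := (hd j).ne'; field_simp
    simp [this]
  · ext u
    congr 1
    ext j
    simp [Matrix.mulVec_diagonal]

/-- The squared Euclidean distance from `x` to the image of `u` under the diagonal map with
entries `c`. -/
def scaledDistSq {n : ℕ} (x c u : Fin n → ℝ) : ℝ := ∑ i, (x i - c i * u i) ^ 2

@[fun_prop]
lemma continuous_scaledDistSq {n : ℕ} (x c : Fin n → ℝ) : Continuous (scaledDistSq x c) := by
  unfold scaledDistSq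
  fun_prop

lemma hasDerivAt_scaledDistSq_insertNth {n : ℕ} (x c : Fin (n + 1) → ℝ) (j : Fin (n + 1)) (s : ℝ)
    (v : Fin n → ℝ) :
    HasDerivAt (fun s => scaledDistSq x c (j.insertNth s v)) (-2 * c j * (x j - c j * s)) s := by
  simp only [scaledDistSq, Fin.sum_univ_succAbove _ j, Fin.insertNth_apply_same,
    Fin.insertNth_apply_succAbove]
  refine HasDerivAt.add_const _ ?_
  refine ((((hasDerivAt_id s).const_mul (c j)).const_sub (x j)).pow 2).congr_deriv ?_
  simp only [id_eq, Nat.cast_ofNat, Nat.add_one_sub_one, pow_one, mul_one]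
  ring

lemma setIntegral_euclideanBall_radial_eq_zero {n : ℕ} {x c : Fin (n + 1) → ℝ} {p : ℝ}
    (hp : 2 * p = 2 - (n + 1 : ℝ)) (hc : ∀ j, c j ≠ 0)
    (hq : ∀ u ∈ euclideanBall (n + 1), scaledDistSq x c u ≠ 0) :
    ∫ u in euclideanBall (n + 1),
      ∑ j, u j * (p * scaledDistSq x c u ^ (p - 1) * ((x j - c j * u j) / c j)) = 0 := by
  have hB := isCompact_euclideanBall (n + 1)
  have hcq : ∀ e : ℝ, ContinuousOn (fun u => scaledDistSq x c u ^ e) (euclideanBall (n + 1)) :=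
    fun e => ContinuousOn.rpow_const (by fun_prop) fun u hu => Or.inl (hq u hu)
  have h1 := hcq (p - 1)
  have h2 := hcq (p - 1 - 1)
  rw [integral_finsetSum]
  swap
  · exact fun j _ => ContinuousOn.integrableOn_compact hB (by fun_prop)
  have hibp : ∀ j, ∫ u in euclideanBall (n + 1),
      u j * (p * scaledDistSq x c u ^ (p - 1) * ((x j - c j * u j) / c j)) =
      ∫ u in euclideanBall (n + 1), (1 - ∑ i, u i ^ 2) / 2 *
        (-2 * p * (p - 1) * scaledDistSq x c u ^ (p - 1 - 1) * (x j - c j * u j) ^ 2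
          - p * scaledDistSq x c u ^ (p - 1)) := by
    intro j
    refine setIntegral_euclideanBall_mul_eq j (by fun_prop) (by fun_prop) fun s v hs => ?_
    have hd := (hasDerivAt_scaledDistSq_insertNth x c j s v).rpow_const (p := p - 1)
      (Or.inl (hq _ hs))
    have hl := (((hasDerivAt_id s).const_mul (c j)).const_sub (x j)).div_const (c j)
    have := (hd.const_mul p).mul hl
    simp only [Fin.insertNth_apply_same]
    refine this.congr_deriv ?_
    have := hc j
    simp only [id_eq]
    field_simp
    ring
  rw [Finset.sum_congr rfl fun j _ => hibp j, ← integral_finsetSum]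
  swap
  · exact fun j _ => ContinuousOn.integrableOn_compact hB (by fun_prop)
  refine setIntegral_eq_zero_of_forall_eq_zero fun u hu => ?_
  have hpos : 0 < scaledDistSq x c u :=
    (Finset.sum_nonneg fun i _ => sq_nonneg _).lt_of_ne' (hq u hu)
  rw [← Finset.mul_sum, Finset.sum_sub_distrib, ← Finset.mul_sum]
  have : scaledDistSq x c u ^ (p - 1) =
      scaledDistSq x c u ^ (p - 1 - 1) * scaledDistSq x c u := by
    rw [← Real.rpow_add_one hpos.ne']
    ring_nf
  rw [show ∑ i, (x i - c i * u i) ^ 2 = scaledDistSq x c u from rfl, this]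
  simp only [Finset.sum_const, Finset.card_univ, Fintype.card_fin, nsmul_eq_mul, Nat.cast_add,
    Nat.cast_one]
  rw [show (n + 1 : ℝ) = 2 - 2 * p by linarith]
  ring

/-- The mean value of the Newtonian kernel over the members of a confocal family of ellipsoids
(and over the limiting focal ellipsoid) does not depend on the parameter. -/
lemma setIntegral_confocal_eq {n : ℕ} {x b : Fin (n + 1) → ℝ} {p T : ℝ}
    (hp : 2 * p = 2 - (n + 1 : ℝ)) (hT : 0 < T) (hb : ∀ j, T ≤ b j)
    (hq : ∀ t ∈ Set.Icc 0 T, ∀ u ∈ euclideanBall (n + 1),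
      scaledDistSq x (fun j => √(b j - t)) u ≠ 0) :
    ∫ u in euclideanBall (n + 1), scaledDistSq x (fun j => √(b j - T)) u ^ p =
      ∫ u in euclideanBall (n + 1), scaledDistSq x (fun j => √(b j - 0)) u ^ p := by
  have hB := isCompact_euclideanBall (n + 1)
  have hBm := hB.measurableSet
  have hfin : IsFiniteMeasure (volume.restrict (euclideanBall (n + 1))) :=
    ⟨by simpa using hB.measure_lt_top⟩
  have hjoint : Continuous fun z : ℝ × (Fin (n + 1) → ℝ) =>
      scaledDistSq x (fun j => √(b j - z.1)) z.2 := by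
    unfold scaledDistSq
    fun_prop
  have hrpow : ∀ e : ℝ, ContinuousOn (fun z : ℝ × (Fin (n + 1) → ℝ) =>
      scaledDistSq x (fun j => √(b j - z.1)) z.2 ^ e) (Set.Icc 0 T ×ˢ euclideanBall (n + 1)) :=
    fun e => hjoint.continuousOn.rpow_const fun z hz => Or.inl (hq z.1 hz.1 z.2 hz.2)
  have hslice : ∀ t ∈ Set.Icc 0 T, ∀ e : ℝ, ContinuousOn
      (fun u => scaledDistSq x (fun j => √(b j - t)) u ^ e) (euclideanBall (n + 1)) :=
    fun t ht e => ContinuousOn.rpow_const (by fun_prop) fun u hu => Or.inl (hq t ht u hu)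
  have hcont : ContinuousOn (fun t => ∫ u in euclideanBall (n + 1),
      scaledDistSq x (fun j => √(b j - t)) u ^ p) (Set.Icc 0 T) := by
    obtain ⟨C, hC⟩ := (isCompact_Icc.prod hB).exists_bound_of_continuousOn (hrpow p)
    refine continuousOn_of_dominated (bound := fun _ => C)
      (fun t ht => (hslice t ht p).aestronglyMeasurable hBm)
      (fun t ht => (ae_restrict_iff' hBm).2 (Filter.Eventually.of_forall fun u hu =>
        hC (t, u) ⟨ht, hu⟩)) (integrable_const _)
      ((ae_restrict_iff' hBm).2 (Filter.Eventually.of_forall fun u hu => ?_))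
    exact (hrpow p).comp (f := fun t => (t, u)) (by fun_prop) fun t ht => ⟨ht, hu⟩
  have hderiv : ∀ t ∈ Set.Ioo 0 T, HasDerivAt (fun t => ∫ u in euclideanBall (n + 1),
      scaledDistSq x (fun j => √(b j - t)) u ^ p) 0 t := by
    intro t ht
    obtain ⟨l, r, htlr, hlr⟩ : ∃ l r, t ∈ Set.Ioo l r ∧ Set.Icc l r ⊆ Set.Ioo 0 T :=
      ⟨t / 2, (t + T) / 2, ⟨by linarith [ht.1], by linarith [ht.2]⟩,
        fun s hs => ⟨by linarith [ht.1, hs.1], by linarith [ht.2, hs.2]⟩⟩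
    have hroot : ∀ s ∈ Set.Icc l r, ∀ j, 0 < b j - s := fun s hs j => by
      linarith [(hlr hs).2, hb j]
    set F' : ℝ → (Fin (n + 1) → ℝ) → ℝ := fun t u =>
      ∑ j, u j * (p * scaledDistSq x (fun j => √(b j - t)) u ^ (p - 1) *
        ((x j - √(b j - t) * u j) / √(b j - t))) with hF'
    have hF'cont : ContinuousOn (fun z : ℝ × (Fin (n + 1) → ℝ) => F' z.1 z.2)
        (Set.Icc l r ×ˢ euclideanBall (n + 1)) := by
      have h1 := (hrpow (p - 1)).mono
        (Set.prod_mono_left (hlr.trans Set.Ioo_subset_Icc_self))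
      refine continuousOn_finsetSum _ fun j _ => ?_
      refine ContinuousOn.mul (by fun_prop) ((continuousOn_const.mul h1).mul ?_)
      exact ContinuousOn.div (by fun_prop) (by fun_prop) fun z hz =>
        (Real.sqrt_pos.2 (hroot z.1 hz.1 j)).ne'
    obtain ⟨C, hC⟩ := (isCompact_Icc.prod hB).exists_bound_of_continuousOn hF'cont
    have hmem : Set.Icc l r ∈ nhds t := Icc_mem_nhds htlr.1 htlr.2
    have htI : t ∈ Set.Icc l r := Set.Ioo_subset_Icc_self htlr
    have hsub : ∀ s ∈ Set.Icc l r, s ∈ Set.Icc 0 T := fun s hs =>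
      Set.Ioo_subset_Icc_self (hlr hs)
    have key := (hasDerivAt_integral_of_dominated_loc_of_deriv_le
      (μ := volume.restrict (euclideanBall (n + 1)))
      (F := fun t u => scaledDistSq x (fun j => √(b j - t)) u ^ p) (F' := F')
      (bound := fun _ => C) hmem
      (Filter.eventually_of_mem hmem fun s hs =>
        (hslice s (hsub s hs) p).aestronglyMeasurable hBm)
      ((hslice t (hsub t htI) p).integrableOn_compact hB)
      ((hF'cont.comp (f := fun u => (t, u)) (by fun_prop)
        fun u hu => ⟨htI, hu⟩).aestronglyMeasurable hBm)
      ((ae_restrict_iff' hBm).2 (Filter.Eventually.of_forall fun u hu s hs =>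
        hC (s, u) ⟨hs, hu⟩)) (integrable_const _)
      ((ae_restrict_iff' hBm).2 (Filter.Eventually.of_forall fun u hu s hs => ?_))).2
    · refine key.congr_deriv ?_
      exact setIntegral_euclideanBall_radial_eq_zero hp
        (fun j => (Real.sqrt_pos.2 (hroot t htI j)).ne') (hq t (hsub t htI))
    · have hsum : HasDerivAt (fun t => scaledDistSq x (fun j => √(b j - t)) u)
          (∑ j, (x j - √(b j - s) * u j) * u j / √(b j - s)) s := by
        refine HasDerivAt.fun_sum fun j _ => ?_
        have hj := hroot s hs j
        have h1 := (((((hasDerivAt_id s).const_sub (b j)).sqrt hj.ne').mul_const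
          (u j)).const_sub (x j)).pow 2
        refine h1.congr_deriv ?_
        have := (Real.sqrt_pos.2 hj).ne'
        simp only [id_eq, Nat.cast_ofNat, Nat.add_one_sub_one, pow_one]
        field_simp
      refine (hsum.rpow_const (p := p) (Or.inl (hq s (hsub s hs) u hu))).congr_deriv ?_
      rw [Finset.sum_mul, Finset.sum_mul]
      refine Finset.sum_congr rfl fun j _ => ?_
      ring
  obtain ⟨t, -, h⟩ := exists_hasDerivAt_eq_slope _ _ hT hcont hderiv
  have := (div_eq_zero_iff.1 h.symm).resolve_right (by linarith)
  linarith

lemma sqrt_zpow_two_sub {q : ℝ} (hq : 0 ≤ q) (m : ℕ) :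
    √q ^ (2 - (m : ℤ)) = q ^ ((2 - (m : ℝ)) / 2) := by
  rw [Real.sqrt_eq_rpow, ← Real.rpow_intCast, ← Real.rpow_mul hq]
  congr 1
  push_cast
  ring

lemma scaledDistSq_sqrt_ne_zero {n : ℕ} {x a : Fin n → ℝ} (hpos : ∀ j, 0 < a j)
    (hx : ¬ ∑ j, x j ^ 2 / a j ^ 2 ≤ 1) {t : ℝ} (ht : 0 ≤ t) (hta : ∀ j, t ≤ a j ^ 2)
    {u : Fin n → ℝ} (hu : u ∈ euclideanBall n) :
    scaledDistSq x (fun j => √(a j ^ 2 - t)) u ≠ 0 := by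
  intro h
  rw [scaledDistSq, Finset.sum_eq_zero_iff_of_nonneg fun _ _ => sq_nonneg _] at h
  refine hx ((Finset.sum_le_sum fun j _ => ?_).trans hu)
  have hj : x j = √(a j ^ 2 - t) * u j := by
    have := h j (Finset.mem_univ j)
    rw [sq_eq_zero_iff] at this
    linarith
  rw [hj, mul_pow, Real.sq_sqrt (by linarith [hta j]), div_le_iff₀ (pow_pos (hpos j) 2)]
  nlinarith [sq_nonneg (u j)]

lemma mother_body_of_ellipsoid_succ {n : ℕ} {a x : Fin (n + 1) → ℝ} (hpos : ∀ j, 0 < a j)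
    (hlt : ∀ j : Fin n, a (Fin.last n) < a j.castSucc)
    (hx : ¬ ∑ j, x j ^ 2 / a j ^ 2 ≤ 1) :
    ∫ y in {y : Fin (n + 1) → ℝ | ∑ j, y j ^ 2 / a j ^ 2 ≤ 1},
        √(∑ j, (x j - y j) ^ 2) ^ (2 - ((n + 1 : ℕ) : ℤ)) =
      ∫ y in {y : Fin n → ℝ | ∑ j, y j ^ 2 / (a j.castSucc ^ 2 - a (Fin.last n) ^ 2) ≤ 1},
        (2 * (∏ j, a j) *
            (∏ j : Fin n, (a j.castSucc ^ 2 - a (Fin.last n) ^ 2)) ^ (-(1 / 2) : ℝ) *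
            √(1 - ∑ j, y j ^ 2 / (a j.castSucc ^ 2 - a (Fin.last n) ^ 2))) *
          √(∑ i, (x i - (Fin.last n).insertNth (α := fun _ => ℝ) 0 y i) ^ 2) ^
            (2 - ((n + 1 : ℕ) : ℤ)) := by
  have hle : ∀ j, a (Fin.last n) ^ 2 ≤ a j ^ 2 := fun j => by
    refine pow_le_pow_left₀ (hpos _).le ?_ 2
    induction j using Fin.lastCases with
    | last => exact le_rfl
    | cast j => exact (hlt j).le
  have hgap : ∀ j : Fin n, 0 < a j.castSucc ^ 2 - a (Fin.last n) ^ 2 := fun j =>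
    sub_pos.2 (pow_lt_pow_left₀ (hlt j) (hpos _).le two_ne_zero)
  have hq : ∀ t ∈ Set.Icc 0 (a (Fin.last n) ^ 2), ∀ u ∈ euclideanBall (n + 1),
      scaledDistSq x (fun j => √(a j ^ 2 - t)) u ≠ 0 := fun t ht u hu =>
    scaledDistSq_sqrt_ne_zero hpos hx ht.1 (fun j => ht.2.trans (hle j)) hu
  have hconf := setIntegral_confocal_eq (x := x) (b := fun j => a j ^ 2)
    (p := (2 - ((n + 1 : ℕ) : ℝ)) / 2) (by push_cast; ring) (pow_pos (hpos _) 2) hle hq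
  have hnn : ∀ y : Fin (n + 1) → ℝ, 0 ≤ ∑ j, (x j - y j) ^ 2 := fun y =>
    Finset.sum_nonneg fun _ _ => sq_nonneg _
  set p := (2 - ((n + 1 : ℕ) : ℝ)) / 2 with hp
  set d : Fin n → ℝ := fun j => √(a j.castSucc ^ 2 - a (Fin.last n) ^ 2) with hd
  have hdpos : ∀ j, 0 < d j := fun j => Real.sqrt_pos.2 (hgap j)
  have hd2 : ∀ j, a j.castSucc ^ 2 - a (Fin.last n) ^ 2 = d j ^ 2 := fun j =>
    (Real.sq_sqrt (hgap j).le).symm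
  have hdprod : 0 < ∏ j, d j := Finset.prod_pos fun j _ => hdpos j
  have hpow : (∏ j, d j ^ 2) ^ (-(1 / 2) : ℝ) = (∏ j, d j)⁻¹ := by
    rw [Finset.prod_pow, Real.rpow_neg (by positivity), ← Real.sqrt_eq_rpow,
      Real.sqrt_sq hdprod.le]
  simp only [sqrt_zpow_two_sub (hnn _), ← hp, hd2, hpow]
  rw [setIntegral_ellipsoid_eq hpos, setIntegral_ellipsoid_eq hdpos]
  simp only [sub_zero, Real.sqrt_sq (hpos _).le] at hconf
  change _ * ∫ u in euclideanBall (n + 1), scaledDistSq x a u ^ p = _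
  rw [← hconf, setIntegral_euclideanBall_succ (Fin.last n), ← integral_const_mul,
    ← integral_const_mul]
  swap
  · exact ContinuousOn.integrableOn_compact (isCompact_euclideanBall _)
      (ContinuousOn.rpow_const (by fun_prop) fun u hu =>
        Or.inl (hq _ ⟨(sq_nonneg _), le_rfl⟩ u hu))
  congr 1
  ext v
  have hslice : ∀ s : ℝ, scaledDistSq x (fun j => √(a j ^ 2 - a (Fin.last n) ^ 2))
      ((Fin.last n).insertNth s v) = ∑ i, (x i -
        (Fin.last n).insertNth (α := fun _ => ℝ) 0 (fun j => d j * v j) i) ^ 2 := fun s => by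
    simp [scaledDistSq, Fin.sum_univ_castSucc, hd]
  have hv : ∀ j, (d j * v j) ^ 2 / d j ^ 2 = v j ^ 2 := fun j => by
    have := (hdpos j).ne'; field_simp
  simp only [hslice, hv, intervalIntegral.integral_const, smul_eq_mul]
  field_simp
  ring

/-- **Corollary 2.4** (the mother body of an ellipsoid): for the ellipsoid
`Ω = {x : Σ xⱼ²/aⱼ² ≤ 1}` with semiaxes `a₁ > ⋯ > a_N > 0`, the measure
`dμ = 2(Π aⱼ)(Π_{j<N}(aⱼ²−a_N²))^{-1/2} (1 − Σ_{j<N} yⱼ²/(aⱼ²−a_N²))^{1/2} dy′` on the focal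
ellipsoid `E = {y : y_N = 0, Σ_{j<N} yⱼ²/(aⱼ²−a_N²) ≤ 1}` produces the same Newtonian
potential as the uniform density on `Ω`, at every point `x ∉ closure Ω`. -/
theorem mother_body_of_ellipsoid
    (N : ℕ) (hN : 3 ≤ N) (a : Fin N → ℝ) (hpos : ∀ j, 0 < a j)
    (hstrict : ∀ i j : Fin N, i < j → a j < a i)
    (x : Fin N → ℝ)
    (hx : x ∉ closure {y : Fin N → ℝ | ∑ j, (y j) ^ 2 / (a j) ^ 2 ≤ 1}) :
    let lN : Fin N := ⟨N - 1, by omega⟩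
    let cast : Fin (N - 1) → Fin N := Fin.castLE (by omega)
    let emb : (Fin (N - 1) → ℝ) → (Fin N → ℝ) :=
      fun y' i => if h : (i : ℕ) < N - 1 then y' ⟨i, h⟩ else 0
    (∫ y in {y : Fin N → ℝ | ∑ j, (y j) ^ 2 / (a j) ^ 2 ≤ 1},
        Real.sqrt (∑ j, (x j - y j) ^ 2) ^ (2 - (N : ℤ))) =
      ∫ y' in {y' : Fin (N - 1) → ℝ |
          ∑ j, (y' j) ^ 2 / ((a (cast j)) ^ 2 - (a lN) ^ 2) ≤ 1},
        (2 * (∏ j, a j) *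
            (∏ j : Fin (N - 1), ((a (cast j)) ^ 2 - (a lN) ^ 2)) ^ (-(1 / 2) : ℝ) *
            Real.sqrt (1 - ∑ j, (y' j) ^ 2 / ((a (cast j)) ^ 2 - (a lN) ^ 2))) *
          Real.sqrt (∑ i, (x i - emb y' i) ^ 2) ^ (2 - (N : ℤ)) := by
  obtain ⟨n, rfl⟩ : ∃ n, N = n + 1 := ⟨N - 1, by omega⟩
  intro lN cast emb
  have hemb : ∀ y i, emb y i = (Fin.last n).insertNth (α := fun _ => ℝ) 0 y i := by
    intro y i
    induction i using Fin.lastCases with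
    | last => simp [emb]
    | cast i => simp [emb]
  have := mother_body_of_ellipsoid_succ hpos (fun j => hstrict _ _ (Fin.castSucc_lt_last j))
    fun h => hx (subset_closure h)
  simp only [hemb]
  exact this
end

section
/- Let N ≥ 3 and a_1 > a_2 > ... > a_N > 0. Let Ω = {x ∈ ℝ^N : Σ_{j=1}^N x_j²/a_j² ≤ 1}, let E = {y ∈ ℝ^N : y_N = 0, Σ_{j=1}^{N−1} y_j²/(a_j² − a_N²) ≤ 1} be the focal ellipsoid, and let μ be the measure on E given by dμ(y) = 2(Π_{j=1}^N a_j)(Π_{j=1}^{N−1}(a_j² − a_N²))^{−1/2}(1 − Σ_{j=1}^{N−1} y_j²/(a_j² − a_N²))^{1/2} dy′, where dy′ is (N−1)-dimensional Lebesgue measure on the hyperplane {y_N = 0}, restricted to E. Then for every function u harmonic on all of ℝ^N: ∫_Ω u(x) dx = ∫_E u(y) dμ(y). In particular μ(E) = vol(Ω). -/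
open MeasureTheory

/-- The closed Euclidean unit ball of `Fin n → ℝ`. -/
def closedEuclideanBall (n : ℕ) : Set (Fin n → ℝ) := {x | ∑ i, x i ^ 2 ≤ 1}

lemma isCompact_closedEuclideanBall (n : ℕ) : IsCompact (closedEuclideanBall n) := by
  refine (isCompact_Icc (a := fun _ : Fin n => (-1 : ℝ)) (b := fun _ => 1)).of_isClosed_subset
    (isClosed_le (by fun_prop) continuous_const) fun x hx => ?_
  have h : ∀ i, |x i| ≤ 1 := fun i => by
    rw [← sq_le_one_iff_abs_le_one]
    exact (Finset.single_le_sum (f := fun i => x i ^ 2) (fun _ _ => sq_nonneg _)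
      (Finset.mem_univ i)).trans hx
  exact ⟨fun i => (abs_le.1 (h i)).1, fun i => (abs_le.1 (h i)).2⟩

lemma setIntegral_mul_diagonal {n : ℕ} {d : Fin n → ℝ} (hd : ∀ i, 0 < d i)
    (s : Set (Fin n → ℝ)) (f : (Fin n → ℝ) → ℝ) :
    ∫ x in s, f x =
      (∏ i, d i) * ∫ x : Fin n → ℝ in {x | (fun i => d i * x i) ∈ s}, f fun i => d i * x i := by
  let e : (Fin n → ℝ) ≃ₜ (Fin n → ℝ) :=
    Homeomorph.piCongrRight fun i => Homeomorph.mulLeft₀ (d i) (hd i).ne'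
  have hdet : (Matrix.diagonal d).det = ∏ i, d i := Matrix.det_diagonal
  have hprod : 0 < ∏ i, d i := Finset.prod_pos fun i _ => hd i
  have hmap := Real.smul_map_diagonal_volume_pi (D := d) (by rw [hdet]; exact hprod.ne')
  have he : ⇑(Matrix.toLin' (Matrix.diagonal d)) = e := by
    ext x i
    simp [e, Matrix.mulVec_diagonal]
  rw [hdet, abs_of_pos hprod, he] at hmap
  conv_lhs => rw [← hmap]
  rw [Measure.restrict_smul, integral_smul_measure, ENNReal.toReal_ofReal hprod.le,
    e.measurableEmbedding.setIntegral_map]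
  rfl

lemma setIntegral_closedEuclideanBall_succ {n : ℕ} (i : Fin (n + 1)) {f : (Fin (n + 1) → ℝ) → ℝ}
    (hf : Continuous f) :
    ∫ x in closedEuclideanBall (n + 1), f x =
      ∫ y : Fin n → ℝ, ∫ t in (-√(1 - ∑ j, y j ^ 2))..√(1 - ∑ j, y j ^ 2),
        f (i.insertNth t y) := by
  have hB := isCompact_closedEuclideanBall (n + 1)
  have hBm := hB.isClosed.measurableSet
  have hmp := (volume_preserving_piFinSuccAbove (fun _ : Fin (n + 1) => ℝ) i).symm
  have hint : Integrable ((closedEuclideanBall (n + 1)).indicator f) :=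
    (hf.continuousOn.integrableOn_compact hB).integrable_indicator hBm
  rw [← integral_indicator hBm, ← hmp.integral_comp',
    Measure.volume_eq_prod, integral_prod_symm]
  · refine integral_congr_ae (Filter.Eventually.of_forall fun y => ?_)
    simp only [MeasurableEquiv.piFinSuccAbove_symm_apply, Fin.insertNthEquiv, Equiv.coe_fn_mk]
    have hmem : ∀ t : ℝ, i.insertNth (α := fun _ => ℝ) t y ∈ closedEuclideanBall (n + 1) ↔
        t ^ 2 ≤ 1 - ∑ j, y j ^ 2 := fun t => by
      simp [closedEuclideanBall, Fin.sum_univ_succAbove _ i, le_sub_iff_add_le]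
    rcases le_or_gt 0 (1 - ∑ j, y j ^ 2) with h | h
    · rw [intervalIntegral.integral_of_le (by linarith [Real.sqrt_nonneg (1 - ∑ j, y j ^ 2)]),
        ← integral_Icc_eq_integral_Ioc, ← integral_indicator measurableSet_Icc]
      refine integral_congr_ae (Filter.Eventually.of_forall fun t => ?_)
      simp only [Set.indicator, hmem, Set.mem_Icc, ← abs_le, Real.le_sqrt (abs_nonneg t) h, sq_abs]
    · rw [Real.sqrt_eq_zero_of_nonpos h.le]
      have : ∀ t : ℝ, ¬ t ^ 2 ≤ 1 - ∑ j, y j ^ 2 := fun t => by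
        linarith [sq_nonneg t, not_le.2 (h.trans_le (sq_nonneg t))]
      simp [Set.indicator, hmem, this]
  · exact (hmp.integrable_comp_emb (MeasurableEquiv.measurableEmbedding _)).2 hint

/-- The integral over the ball of a partial derivative of a function vanishing on the sphere
is zero. -/
lemma setIntegral_closedEuclideanBall_hasDerivAt {n : ℕ} (i : Fin (n + 1))
    {g g' : (Fin (n + 1) → ℝ) → ℝ} (hg' : Continuous g')
    (hderiv : ∀ x, HasDerivAt (fun t => g (Function.update x i t)) (g' x) (x i))
    (hzero : ∀ x, ∑ j, x j ^ 2 = 1 → g x = 0) :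
    ∫ x in closedEuclideanBall (n + 1), g' x = 0 := by
  rw [setIntegral_closedEuclideanBall_succ i hg']
  refine integral_eq_zero_of_ae (Filter.Eventually.of_forall fun y => ?_)
  simp only [Pi.zero_apply]
  rcases le_or_gt (1 - ∑ j, y j ^ 2) 0 with h | h
  · simp [Real.sqrt_eq_zero_of_nonpos h]
  · have hc : Continuous fun t : ℝ => g' (i.insertNth (α := fun _ => ℝ) t y) :=
      hg'.comp (by fun_prop)
    rw [intervalIntegral.integral_eq_sub_of_hasDerivAt
      (f := fun t => g (i.insertNth (α := fun _ => ℝ) t y))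
      (fun t _ => by simpa using hderiv (i.insertNth (α := fun _ => ℝ) t y))
      (hc.intervalIntegrable _ _), hzero, hzero, sub_zero]
    all_goals simp [Fin.sum_univ_succAbove _ i, Real.sq_sqrt h.le]

lemma hasDerivAt_setIntegral_of_isCompact {n : ℕ} {K : Set (Fin n → ℝ)} (hK : IsCompact K)
    {s : Set ℝ} (hs : IsCompact s) {t₀ : ℝ} (ht₀ : s ∈ nhds t₀) {F F' : ℝ → (Fin n → ℝ) → ℝ}
    (hF : ∀ t, Continuous (F t)) (hF' : ContinuousOn (Function.uncurry F') (s ×ˢ K))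
    (hderiv : ∀ t ∈ s, ∀ x, HasDerivAt (F · x) (F' t x) t) :
    HasDerivAt (fun t => ∫ x in K, F t x) (∫ x in K, F' t₀ x) t₀ := by
  have hKm := hK.isClosed.measurableSet
  obtain ⟨M, hM⟩ := (hs.prod hK).exists_bound_of_continuousOn hF'
  refine (hasDerivAt_integral_of_dominated_loc_of_deriv_le (bound := fun _ => M) ht₀
    (Filter.Eventually.of_forall fun t => (hF t).aestronglyMeasurable)
    ((hF t₀).continuousOn.integrableOn_compact hK) ?_ ?_ ?_ ?_).2
  · have : ContinuousOn (F' t₀) K := hF'.comp (f := fun x => (t₀, x)) (by fun_prop)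
      fun x hx => ⟨mem_of_mem_nhds ht₀, hx⟩
    exact this.aestronglyMeasurable hKm
  · exact (ae_restrict_iff' hKm).2 (Filter.Eventually.of_forall fun x hx t ht => hM (t, x) ⟨ht, hx⟩)
  · exact integrableOn_const hK.measure_lt_top.ne
  · exact Filter.Eventually.of_forall fun x t ht => hderiv t ht x

section Confocal

variable {n : ℕ} {u : (Fin (n + 1) → ℝ) → ℝ} {c : Fin (n + 1) → ℝ}

lemma contDiff_partial (hu : ContDiff ℝ 2 u) (i : Fin (n + 1)) :
    ContDiff ℝ 1 fun y => fderiv ℝ u y (Pi.single i 1) :=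
  (hu.fderiv_right (m := 1) (by norm_num)).clm_apply contDiff_const

/-- The derivative of the average of a harmonic function along a confocal family of ellipsoids
vanishes. -/
lemma setIntegral_confocal_derivative_eq_zero (hu : ContDiff ℝ 2 u) (hharm : ∀ x, lap u x = 0)
    {d : Fin (n + 1) → ℝ} (hd : ∀ i, 0 < d i) :
    ∫ x in closedEuclideanBall (n + 1),
      fderiv ℝ u (fun i => d i * x i) (fun i => x i / (2 * d i)) = 0 := by
  let p : Fin (n + 1) → (Fin (n + 1) → ℝ) → ℝ := fun i y => fderiv ℝ u y (Pi.single i 1)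
  have hp : ∀ i, ContDiff ℝ 1 (p i) := contDiff_partial hu
  let g' : Fin (n + 1) → (Fin (n + 1) → ℝ) → ℝ := fun i x =>
    (-(2 * x i)) * (p i (fun k => d k * x k) / d i) +
      (1 - ∑ j, x j ^ 2) * fderiv ℝ (p i) (fun k => d k * x k) (Pi.single i 1)
  have hg' : ∀ i, Continuous (g' i) := fun i => by
    have h1 : Continuous fun x : Fin (n + 1) → ℝ => p i (fun k => d k * x k) :=
      (hp i).continuous.comp (by fun_prop)
    have h2 : Continuous fun x : Fin (n + 1) → ℝ =>
        fderiv ℝ (p i) (fun k => d k * x k) (Pi.single i 1) :=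
      (((hp i).continuous_fderiv (by norm_num)).comp (by fun_prop)).clm_apply continuous_const
    fun_prop
  have hzero : ∀ i, ∫ x in closedEuclideanBall (n + 1), g' i x = 0 := fun i => by
    refine setIntegral_closedEuclideanBall_hasDerivAt i
      (g := fun x => (1 - ∑ j, x j ^ 2) * (p i (fun k => d k * x k) / d i)) (hg' i)
      (fun x => ?_) fun x hx => by simp [hx]
    have hupd := hasDerivAt_pi.1 (hasDerivAt_update x i (x i))
    have hsum : HasDerivAt (fun t => 1 - ∑ j, Function.update x i t j ^ 2) (-(2 * x i)) (x i) := by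
      have := (HasDerivAt.fun_sum fun j (_ : j ∈ Finset.univ) => (hupd j).pow 2).const_sub 1
      convert! this using 1
      simp [Pi.single_apply]
    have hcurve : HasDerivAt (fun t => fun k => d k * Function.update x i t k)
        (d i • Pi.single i (1 : ℝ)) (x i) := by
      refine hasDerivAt_pi.2 fun k => ?_
      convert! (hupd k).const_mul (d k) using 1
      rcases eq_or_ne k i with rfl | h <;> simp [*]
    have hpc : HasDerivAt (fun t => p i (fun k => d k * Function.update x i t k))
        (fderiv ℝ (p i) (fun k => d k * x k) (d i • Pi.single i 1)) (x i) := by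
      have hpf : HasFDerivAt (p i) (fderiv ℝ (p i) (fun k => d k * x k))
          (fun k => d k * Function.update x i (x i) k) := by
        simpa using ((hp i).differentiable (by norm_num) (fun k => d k * x k)).hasFDerivAt
      exact hpf.comp_hasDerivAt (x i) hcurve
    convert! hsum.mul (hpc.div_const (d i)) using 1
    simp [g', (hd i).ne']
  have hkey : ∀ x : Fin (n + 1) → ℝ,
      fderiv ℝ u (fun i => d i * x i) (fun i => x i / (2 * d i)) = -(1 / 4) * ∑ i, g' i x := by
    intro x
    have hl : ∑ i, fderiv ℝ (p i) (fun k => d k * x k) (Pi.single i 1) = 0 := hharm _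
    simp only [g', Finset.sum_add_distrib, ← Finset.mul_sum, hl, mul_zero, add_zero]
    have hv : (fun i => x i / (2 * d i)) =
        ∑ i, (x i / (2 * d i)) • (Pi.single i (1 : ℝ) : Fin (n + 1) → ℝ) := by
      ext k
      simp [Finset.sum_apply, Pi.single_apply]
    rw [hv, map_sum, Finset.mul_sum]
    refine Finset.sum_congr rfl fun i _ => ?_
    rw [map_smul, smul_eq_mul]
    have := (hd i).ne'
    simp only [p]
    field_simp
    ring
  simp_rw [hkey]
  rw [integral_const_mul, integral_finsetSum]
  · simp [hzero]
  · exact fun i _ => (hg' i).continuousOn.integrableOn_compact (isCompact_closedEuclideanBall _)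

lemma hasDerivAt_setIntegral_confocal (hu : ContDiff ℝ 2 u) (hharm : ∀ x, lap u x = 0)
    (hc : ∀ i, 0 ≤ c i) {t₀ : ℝ} (ht₀ : 0 < t₀) :
    HasDerivAt (fun t => ∫ x in closedEuclideanBall (n + 1), u fun i => √(c i + t) * x i) 0 t₀ := by
  rw [← setIntegral_confocal_derivative_eq_zero hu hharm (d := fun i => √(c i + t₀))
    fun i => Real.sqrt_pos.2 (by linarith [hc i])]
  have hpos : ∀ t ∈ Set.Icc (t₀ / 2) (2 * t₀), ∀ i, 0 < c i + t := fun t ht i => by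
    linarith [hc i, ht.1]
  refine hasDerivAt_setIntegral_of_isCompact (isCompact_closedEuclideanBall _)
    (isCompact_Icc (a := t₀ / 2) (b := 2 * t₀)) (Icc_mem_nhds (by linarith) (by linarith))
    (F := fun t x => u fun i => √(c i + t) * x i)
    (F' := fun t x => fderiv ℝ u (fun i => √(c i + t) * x i) fun i => x i / (2 * √(c i + t)))
    (fun t => hu.continuous.comp (by fun_prop)) ?_ fun t ht x => ?_
  · refine ContinuousOn.clm_apply (Continuous.continuousOn
      ((hu.continuous_fderiv (by norm_num)).comp (by fun_prop))) ?_
    refine continuousOn_pi.2 fun i => ContinuousOn.div (by fun_prop) (by fun_prop) ?_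
    exact fun q hq => by have := Real.sqrt_pos.2 (hpos q.1 hq.1 i); positivity
  · refine HasFDerivAt.comp_hasDerivAt t
      (hu.differentiable (by norm_num) _).hasFDerivAt (hasDerivAt_pi.2 fun i => ?_)
    have := (((hasDerivAt_id t).const_add (c i)).sqrt (hpos t ht i).ne').mul_const (x i)
    convert! this using 1
    simp only [id]
    ring

/-- **MacLaurin's theorem**, up to and including the degenerate member of the confocal family. -/
lemma setIntegral_confocal_eq_s9 (hu : ContDiff ℝ 2 u) (hharm : ∀ x, lap u x = 0)
    (hc : ∀ i, 0 ≤ c i) {t : ℝ} (ht : 0 < t) :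
    ∫ x in closedEuclideanBall (n + 1), u (fun i => √(c i + t) * x i) =
      ∫ x in closedEuclideanBall (n + 1), u (fun i => √(c i) * x i) := by
  have hcont : Continuous fun t => ∫ x in closedEuclideanBall (n + 1),
      u fun i => √(c i + t) * x i :=
    continuous_parametric_integral_of_continuous
      (f := fun (t : ℝ) (x : Fin (n + 1) → ℝ) => u fun i => √(c i + t) * x i)
      (hu.continuous.comp (g := u) (f := fun q : ℝ × (Fin (n + 1) → ℝ) => fun i =>
        √(c i + q.1) * q.2 i) (by fun_prop))
      (isCompact_closedEuclideanBall _)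
  obtain ⟨s, -, hs⟩ := exists_hasDerivAt_eq_slope _ (fun _ => (0 : ℝ)) ht hcont.continuousOn
    fun s hs => hasDerivAt_setIntegral_confocal hu hharm hc hs.1
  have h := (div_eq_zero_iff.1 hs.symm).resolve_right (by linarith)
  simpa using sub_eq_zero.1 h

end Confocal

lemma setIntegral_ellipsoid_eq_s9 {n : ℕ} {a : Fin (n + 1) → ℝ} (hpos : ∀ j, 0 < a j)
    (hlt : ∀ j : Fin n, a (Fin.last n) < a j.castSucc) {u : (Fin (n + 1) → ℝ) → ℝ}
    (hu : ContDiff ℝ 2 u) (hharm : ∀ x, lap u x = 0) :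
    ∫ x in {x : Fin (n + 1) → ℝ | ∑ j, x j ^ 2 / a j ^ 2 ≤ 1}, u x =
      ∫ y in {y : Fin n → ℝ | ∑ j, y j ^ 2 / (a j.castSucc ^ 2 - a (Fin.last n) ^ 2) ≤ 1},
        2 * (∏ j, a j) *
          (∏ j : Fin n, (a j.castSucc ^ 2 - a (Fin.last n) ^ 2)) ^ (-(1 / 2) : ℝ) *
          √(1 - ∑ j, y j ^ 2 / (a j.castSucc ^ 2 - a (Fin.last n) ^ 2)) *
          u (Fin.snoc (α := fun _ => ℝ) y 0) := by
  set l := a (Fin.last n) with hl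
  have hl0 : 0 < l := hpos _
  have hbpos : ∀ j : Fin n, 0 < a j.castSucc ^ 2 - l ^ 2 := fun j => by
    have := hlt j
    nlinarith
  set b : Fin n → ℝ := fun j => √(a j.castSucc ^ 2 - l ^ 2) with hb
  have hb0 : ∀ j, 0 < b j := fun j => Real.sqrt_pos.2 (hbpos j)
  have hbsq : ∀ j, b j ^ 2 = a j.castSucc ^ 2 - l ^ 2 := fun j => Real.sq_sqrt (hbpos j).le
  have hc : ∀ i, 0 ≤ a i ^ 2 - l ^ 2 := fun i => by
    induction i using Fin.lastCases with
    | last => simp [hl]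
    | cast j => exact (hbpos j).le
  have hprod : (∏ j : Fin n, (a j.castSucc ^ 2 - l ^ 2)) ^ (-(1 / 2) : ℝ) = (∏ j, b j)⁻¹ := by
    rw [Real.rpow_neg (Finset.prod_nonneg fun j _ => (hbpos j).le), ← Real.sqrt_eq_rpow,
      Real.sqrt_prod _ fun j _ => (hbpos j).le]
  have hbprod : 0 < ∏ j, b j := Finset.prod_pos fun j _ => hb0 j
  have hdiag : ∀ x : Fin (n + 1) → ℝ,
      (∑ j, (a j * x j) ^ 2 / a j ^ 2 ≤ 1) ↔ ∑ j, x j ^ 2 ≤ 1 := fun x => by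
    simp [mul_pow, mul_div_cancel_left₀, (hpos _).ne']
  have hdiag' : ∀ y : Fin n → ℝ, ∑ j, (b j * y j) ^ 2 / b j ^ 2 = ∑ j, y j ^ 2 := fun y => by
    simp [mul_pow, mul_div_cancel_left₀, (hb0 _).ne']
  have hmac := setIntegral_confocal_eq_s9 hu hharm hc (sq_pos_of_pos hl0)
  simp only [sub_add_cancel, Real.sqrt_sq (hpos _).le] at hmac
  rw [setIntegral_mul_diagonal hpos]
  simp only [Set.mem_ofPred_eq, hdiag]
  change _ * (∫ x in closedEuclideanBall (n + 1), u fun i => a i * x i) = _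
  have hslice := setIntegral_closedEuclideanBall_succ (Fin.last n)
    (f := fun x => u fun i => √(a i ^ 2 - l ^ 2) * x i) (hu.continuous.comp (by fun_prop))
  rw [hmac, hslice, setIntegral_eq_integral_of_forall_compl_eq_zero]
  · have hscale := setIntegral_mul_diagonal hb0 Set.univ fun y =>
      2 * (∏ j, a j) * (∏ j : Fin n, (a j.castSucc ^ 2 - l ^ 2)) ^ (-(1 / 2) : ℝ) *
        √(1 - ∑ j, y j ^ 2 / (a j.castSucc ^ 2 - l ^ 2)) * u (Fin.snoc (α := fun _ => ℝ) y 0)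
    simp only [Set.mem_univ, Set.ofPred_true, setIntegral_univ] at hscale
    rw [hscale]
    simp only [← hbsq, hdiag']
    rw [← integral_const_mul, ← integral_const_mul]
    refine integral_congr_ae (Filter.Eventually.of_forall fun y => ?_)
    have hpt : ∀ t : ℝ, (fun i => √(a i ^ 2 - l ^ 2) *
        (Fin.last n).insertNth (α := fun _ => ℝ) t y i) =
          Fin.snoc (α := fun _ => ℝ) (fun j => b j * y j) 0 := fun t => by
      ext i
      induction i using Fin.lastCases with
      | last => simp [hl]
      | cast j => simp [hb]
    simp only [hpt, intervalIntegral.integral_const, hbsq, hprod, smul_eq_mul]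
    field_simp
    ring
  · intro y hy
    rw [Real.sqrt_eq_zero_of_nonpos (by simpa using (not_le.1 hy).le)]
    simp

/-- The quadrature identity for the mother body measure `μ` of the ellipsoid
`Ω = {x : Σ xⱼ²/aⱼ² ≤ 1}` (`a₁ > ⋯ > a_N > 0`), supported on the focal ellipsoid
`E = {y : y_N = 0, Σ_{j<N} yⱼ²/(aⱼ²−a_N²) ≤ 1}` with density
`2(Π aⱼ)(Π_{j<N}(aⱼ²−a_N²))^{-1/2}(1 − Σ_{j<N} yⱼ²/(aⱼ²−a_N²))^{1/2}` with respect to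
`(N−1)`-dimensional Lebesgue measure: for every entire harmonic `u`,
`∫_Ω u dx = ∫_E u dμ`; in particular (taking `u ≡ 1`) `μ(E) = vol(Ω)`. -/
theorem mother_body_quadrature_for_harmonic_functions
    (N : ℕ) (hN : 3 ≤ N) (a : Fin N → ℝ) (hpos : ∀ j, 0 < a j)
    (hstrict : ∀ i j : Fin N, i < j → a j < a i)
    (u : (Fin N → ℝ) → ℝ) (hu : ContDiff ℝ 2 u) (hharm : ∀ x, lap u x = 0) :
    let lN : Fin N := ⟨N - 1, by omega⟩
    let cast : Fin (N - 1) → Fin N := Fin.castLE (by omega)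
    let emb : (Fin (N - 1) → ℝ) → (Fin N → ℝ) :=
      fun y' i => if h : (i : ℕ) < N - 1 then y' ⟨i, h⟩ else 0
    let ρ : (Fin (N - 1) → ℝ) → ℝ := fun y' =>
      2 * (∏ j, a j) *
        (∏ j : Fin (N - 1), ((a (cast j)) ^ 2 - (a lN) ^ 2)) ^ (-(1 / 2) : ℝ) *
        Real.sqrt (1 - ∑ j, (y' j) ^ 2 / ((a (cast j)) ^ 2 - (a lN) ^ 2))
    let E' : Set (Fin (N - 1) → ℝ) :=
      {y' | ∑ j, (y' j) ^ 2 / ((a (cast j)) ^ 2 - (a lN) ^ 2) ≤ 1}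
    let Ω : Set (Fin N → ℝ) := {x | ∑ j, (x j) ^ 2 / (a j) ^ 2 ≤ 1}
    (∫ x in Ω, u x) = (∫ y' in E', ρ y' * u (emb y')) ∧
      (∫ y' in E', ρ y') = (volume Ω).toReal := by
  obtain ⟨n, rfl⟩ : ∃ n, N = n + 1 := ⟨N - 1, by omega⟩
  intro lN cast emb ρ E' Ω
  have hlt : ∀ j : Fin n, a (Fin.last n) < a j.castSucc := fun j =>
    hstrict _ _ (Fin.castSucc_lt_last j)
  have hemb : ∀ y, emb y = Fin.snoc (α := fun _ => ℝ) y 0 := fun y => by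
    ext i
    simp only [emb, Fin.snoc]
    rfl
  constructor
  · simp only [hemb]
    exact setIntegral_ellipsoid_eq_s9 hpos hlt hu hharm
  · have h := setIntegral_ellipsoid_eq_s9 hpos hlt (u := fun _ => 1) contDiff_const
      fun x => by simp [lap]
    simp only [mul_one, setIntegral_const, smul_eq_mul] at h
    exact h.symm
end
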